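/- arXiv:1309.3751 — 5 statements merged into one kernel-verified Lean document; each statement's English description precedes it below -/
import Mathlib

section
/- For every a ∈ ℝ, the family of functions {x ↦ h_k(x + ia) : k ∈ ℕ} (elements of L²(ℝ, ℂ)) is complete in L²(ℝ, ℂ): the closure of the ℂ-linear span of this family is all of L²(ℝ, ℂ). -/
open MeasureTheory

/-- The physicists' Hermite polynomial `H_k`, extended to an entire function on `ℂ`. -/
noncomputable def physHermiteC (k : ℕ) (z : ℂ) : ℂ :=
  (-1) ^ k * Complex.exp (z ^ 2) * iteratedDeriv k (fun w : ℂ => Complex.exp (-w ^ 2)) z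

/-- The Hermite function `h_k` as an entire function on `ℂ`. -/
noncomputable def hermiteFunC (k : ℕ) (z : ℂ) : ℂ :=
  ((Real.sqrt (2 ^ k * Nat.factorial k * Real.sqrt Real.pi) : ℝ) : ℂ)⁻¹ *
    physHermiteC k z * Complex.exp (-z ^ 2 / 2)

open Polynomial FourierTransform

open scoped ContDiff

/-- The physicists' Hermite polynomials as elements of `ℂ[X]`. -/
noncomputable def physHermitePoly : ℕ → ℂ[X]
  | 0 => 1
  | k + 1 => C 2 * X * physHermitePoly k - derivative (physHermitePoly k)

theorem degree_physHermitePoly (k : ℕ) : (physHermitePoly k).degree = k := by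
  induction k with
  | zero => simp [physHermitePoly]
  | succ k ih =>
    have hne : physHermitePoly k ≠ 0 := by
      intro h
      simp [h] at ih
    have hdeg : (C 2 * X * physHermitePoly k).degree = ((k + 1 : ℕ) : WithBot ℕ) := by
      rw [degree_mul, ih, degree_C_mul_X two_ne_zero]
      push_cast
      exact add_comm _ _
    rw [physHermitePoly, degree_sub_eq_left_of_degree_lt, hdeg]
    rw [hdeg]
    refine (degree_derivative_lt hne).trans ?_
    rw [ih]
    exact_mod_cast Nat.lt_succ_self k

theorem iteratedDeriv_cexp_neg_sq (k : ℕ) :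
    iteratedDeriv k (fun w : ℂ => Complex.exp (-w ^ 2)) =
      fun z => (-1) ^ k * (physHermitePoly k).eval z * Complex.exp (-z ^ 2) := by
  induction k with
  | zero => simp [physHermitePoly]
  | succ k ih =>
    rw [iteratedDeriv_succ, ih]
    funext z
    have hexp : HasDerivAt (fun w : ℂ => Complex.exp (-w ^ 2))
        (Complex.exp (-z ^ 2) * (-(2 * z))) z := by
      simpa using ((hasDerivAt_pow 2 z).neg).cexp
    have h := (((physHermitePoly k).hasDerivAt z).const_mul ((-1 : ℂ) ^ k)).mul hexp
    refine h.deriv.trans ?_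
    simp only [physHermitePoly, eval_sub, eval_mul, eval_C, eval_X]
    ring

theorem physHermiteC_eq_eval (k : ℕ) (z : ℂ) :
    physHermiteC k z = (physHermitePoly k).eval z := by
  have hsign : (-1 : ℂ) ^ k * (-1) ^ k = 1 := by rw [← mul_pow]; simp
  have hexp : Complex.exp (z ^ 2) * Complex.exp (-z ^ 2) = 1 := by
    rw [← Complex.exp_add]; simp
  rw [physHermiteC, iteratedDeriv_cexp_neg_sq]
  linear_combination (physHermitePoly k).eval z * hexp * (-1 : ℂ) ^ k * (-1) ^ k +
    (physHermitePoly k).eval z * hsign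

theorem span_range_physHermitePoly : Submodule.span ℂ (Set.range physHermitePoly) = ⊤ := by
  let S : Polynomial.Sequence ℂ := ⟨physHermitePoly, degree_physHermitePoly⟩
  exact S.span fun i => (leadingCoeff_ne_zero.mpr (S.ne_zero i)).isUnit

/-- On a horizontal line, a polynomial grows at most exponentially. -/
theorem exists_norm_eval_add_mul_I_le (p : ℂ[X]) (a : ℝ) :
    ∃ M : ℝ, ∀ x : ℝ, ‖p.eval ((x : ℂ) + a * Complex.I)‖ ≤ M * Real.exp |x| := by
  induction p using Polynomial.induction_on' with
  | add p q hp hq =>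
    obtain ⟨M, hM⟩ := hp
    obtain ⟨N, hN⟩ := hq
    refine ⟨M + N, fun x => ?_⟩
    rw [eval_add, add_mul]
    exact (norm_add_le _ _).trans (add_le_add (hM x) (hN x))
  | monomial n c =>
    refine ⟨‖c‖ * (n.factorial * Real.exp |a|), fun x => ?_⟩
    have hnorm : ‖(x : ℂ) + a * Complex.I‖ ≤ |a| + |x| := by
      refine (norm_add_le _ _).trans ?_
      simp [add_comm]
    have hpow := Real.pow_div_factorial_le_exp (|a| + |x|) (by positivity) n
    rw [div_le_iff₀ (by positivity), Real.exp_add] at hpow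
    rw [eval_monomial, norm_mul, norm_pow, mul_assoc]
    gcongr
    calc ‖(x : ℂ) + a * Complex.I‖ ^ n ≤ (|a| + |x|) ^ n := by gcongr
      _ ≤ _ := hpow
      _ = _ := by ring

theorem norm_cexp_neg_add_mul_I_sq_div_two (a x : ℝ) :
    ‖Complex.exp (-((x : ℂ) + a * Complex.I) ^ 2 / 2)‖ =
      Real.exp (a ^ 2 / 2) * Real.exp (-x ^ 2 / 2) := by
  rw [Complex.norm_exp, ← Real.exp_add]
  congr 1
  simp [pow_two]
  ring

theorem memLp_two_of_norm_le_exp_mul_gaussian {f : ℝ → ℂ} (hf : Continuous f) {M c : ℝ}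
    (h : ∀ x, ‖f x‖ ≤ M * Real.exp (c * |x|) * Real.exp (-x ^ 2 / 2)) :
    MemLp f 2 (volume : Measure ℝ) := by
  have hM : 0 ≤ M := by simpa using (norm_nonneg _).trans (h 0)
  have hg : MemLp (fun x : ℝ => Real.exp (-x ^ 2 / 4)) 2 (volume : Measure ℝ) := by
    rw [memLp_two_iff_integrable_sq (by fun_prop)]
    refine (integrable_exp_neg_mul_sq (b := 1 / 2) (by norm_num)).congr (.of_forall fun x => ?_)
    simp only [← Real.exp_nat_mul]
    congr 1
    push_cast
    ring
  refine hg.of_le_mul (c := M * Real.exp (c ^ 2)) hf.aestronglyMeasurable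
    (.of_forall fun x => (h x).trans ?_)
  rw [Real.norm_of_nonneg (Real.exp_nonneg _), mul_assoc, mul_assoc, ← Real.exp_add,
    ← Real.exp_add]
  refine mul_le_mul_of_nonneg_left (Real.exp_le_exp.mpr ?_) hM
  nlinarith [sq_nonneg (c - |x| / 2), sq_abs x]

/-- If `exp (c |x|) f x` is integrable for all `c` and all moments of `f` vanish, then so does its
Fourier transform. -/
theorem fourier_eq_zero_of_moments_eq_zero {f : ℝ → ℂ}
    (hf : ∀ c : ℝ, Integrable fun x : ℝ => Real.exp (c * |x|) * ‖f x‖)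
    (hfm : AEStronglyMeasurable f)
    (hmom : ∀ n : ℕ, ∫ x : ℝ, (x : ℂ) ^ n * f x = 0) (w : ℝ) : 𝓕 f w = 0 := by
  rw [Real.fourier_real_eq_integral_exp_smul]
  set b : ℂ := -2 * Real.pi * w * Complex.I with hb
  have hterm (x : ℝ) : HasSum (fun n : ℕ => (b * x) ^ n / n.factorial * f x)
      (Complex.exp (↑(-2 * Real.pi * x * w) * Complex.I) • f x) := by
    have : (↑(-2 * Real.pi * x * w) * Complex.I : ℂ) = b * x := by
      rw [hb]; push_cast; ring
    rw [this, smul_eq_mul, Complex.exp_eq_exp_ℂ]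
    exact (NormedSpace.expSeries_div_hasSum_exp (b * x : ℂ)).mul_right _
  have hbound (x : ℝ) : HasSum (fun n : ℕ => (‖b‖ * |x|) ^ n / n.factorial * ‖f x‖)
      (Real.exp (‖b‖ * |x|) * ‖f x‖) := by
    rw [Real.exp_eq_exp_ℝ]
    exact (NormedSpace.expSeries_div_hasSum_exp (‖b‖ * |x|)).mul_right _
  have key := hasSum_integral_of_dominated_convergence (μ := (volume : Measure ℝ))
    (F := fun (n : ℕ) (x : ℝ) => (b * x) ^ n / n.factorial * f x)
    (fun n x => (‖b‖ * |x|) ^ n / n.factorial * ‖f x‖)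
    (fun n => AEStronglyMeasurable.mul (by fun_prop) hfm)
    (fun n => .of_forall fun x => by simp) (.of_forall fun x => (hbound x).summable)
    (by simpa only [(hbound _).tsum_eq] using hf ‖b‖) (.of_forall hterm)
  have hzero (n : ℕ) : ∫ x : ℝ, (b * x) ^ n / n.factorial * f x = 0 := by
    have : ∀ x : ℝ, (b * x) ^ n / n.factorial * f x =
        b ^ n / n.factorial * ((x : ℂ) ^ n * f x) := fun x => by ring
    simp_rw [this]
    rw [integral_const_mul, hmom, mul_zero]
  simp only [hzero] at key
  exact key.unique hasSum_zero

/-- An integrable function with vanishing Fourier transform vanishes almost everywhere. -/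
theorem ae_eq_zero_of_fourier_eq_zero {f : ℝ → ℂ} (hf : Integrable f) (h : ∀ w, 𝓕 f w = 0) :
    ∀ᵐ x, f x = 0 := by
  refine ae_eq_zero_of_integral_contDiff_smul_eq_zero hf.locallyIntegrable fun g hg hgc => ?_
  let φ : SchwartzMap ℝ ℂ := (hgc.comp_left (g := ((↑) : ℝ → ℂ)) rfl).toSchwartzMap
    (Complex.ofRealCLM.contDiff.comp hg)
  have hφ (x : ℝ) : (𝓕 (𝓕⁻ φ : SchwartzMap ℝ ℂ) : SchwartzMap ℝ ℂ) x = g x := by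
    rw [FourierTransform.fourier_fourierInv_eq]
    rfl
  have key := VectorFourier.integral_fourierIntegral_smul_eq_flip (L := innerₗ ℝ)
    (μ := (volume : Measure ℝ)) (ν := (volume : Measure ℝ))
    Real.continuous_fourierChar continuous_inner (𝓕⁻ φ : SchwartzMap ℝ ℂ).integrable hf
  have hright (x : ℝ) :
      VectorFourier.fourierIntegral Real.fourierChar volume (innerₗ ℝ).flip f x = 0 := by
    rw [flip_innerₗ]
    exact h x
  have hleft (x : ℝ) : VectorFourier.fourierIntegral Real.fourierChar volume (innerₗ ℝ)
      (𝓕⁻ φ : SchwartzMap ℝ ℂ) x = g x := by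
    rw [← hφ x, SchwartzMap.fourier_coe]
    rfl
  simpa only [hright, hleft, smul_zero, integral_zero, Complex.coe_smul] using key

/-- For every `a ∈ ℝ`, the family `{x ↦ h_k(x + ia) : k ∈ ℕ}` is complete in `L²(ℝ, ℂ)`:
the closure of its `ℂ`-linear span is everything. -/
theorem stmt_5 (a : ℝ) :
    (Submodule.span ℂ
        {g : Lp ℂ 2 (volume : Measure ℝ) |
          ∃ k : ℕ, (g : ℝ → ℂ) =ᵐ[(volume : Measure ℝ)]
            fun x : ℝ => hermiteFunC k ((x : ℂ) + a * Complex.I)}).topologicalClosure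
      = ⊤ := by
  rw [Submodule.topologicalClosure_eq_top_iff, Submodule.eq_bot_iff]
  intro g hg
  set E : ℝ → ℂ := fun x => Complex.exp (-((x : ℂ) + a * Complex.I) ^ 2 / 2) with hE
  have hEc : Continuous E := by fun_prop
  have hpE (p : ℂ[X]) :
      MemLp (fun x : ℝ => p.eval ((x : ℂ) + a * Complex.I) * E x) 2 (volume : Measure ℝ) := by
    obtain ⟨M, hM⟩ := exists_norm_eval_add_mul_I_le p a
    refine memLp_two_of_norm_le_exp_mul_gaussian (M := M * Real.exp (a ^ 2 / 2)) (c := 1)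
      (by fun_prop) fun x => ?_
    rw [norm_mul, norm_cexp_neg_add_mul_I_sq_div_two, one_mul]
    calc _ ≤ (M * Real.exp |x|) * (Real.exp (a ^ 2 / 2) * Real.exp (-x ^ 2 / 2)) := by
          gcongr
          exact hM x
      _ = _ := by ring
  have hgs : MemLp (fun x => star (g x)) 2 (volume : Measure ℝ) := (Lp.memLp g).star
  have hint (p : ℂ[X]) :
      Integrable fun x : ℝ => p.eval ((x : ℂ) + a * Complex.I) * E x * star (g x) :=
    (hpE p).integrable_mul hgs
  have horth (p : ℂ[X]) :
      ∫ x : ℝ, p.eval ((x : ℂ) + a * Complex.I) * E x * star (g x) = 0 := by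
    have hp : p ∈ Submodule.span ℂ (Set.range physHermitePoly) := by
      rw [span_range_physHermitePoly]
      trivial
    induction hp using Submodule.span_induction with
    | mem p hp =>
      obtain ⟨k, rfl⟩ := hp
      set c : ℂ := ((Real.sqrt (2 ^ k * Nat.factorial k * Real.sqrt Real.pi) : ℝ) : ℂ) with hc
      have hc0 : c ≠ 0 := by
        rw [hc, Complex.ofReal_ne_zero]
        positivity
      set u := (hpE (physHermitePoly k)).toLp
      have hu : (c⁻¹ • u : Lp ℂ 2 (volume : Measure ℝ)) ∈ {g : Lp ℂ 2 (volume : Measure ℝ) |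
          ∃ k : ℕ, (g : ℝ → ℂ) =ᵐ[(volume : Measure ℝ)]
            fun x : ℝ => hermiteFunC k ((x : ℂ) + a * Complex.I)} := by
        refine ⟨k, ?_⟩
        filter_upwards [Lp.coeFn_smul c⁻¹ u, (hpE (physHermitePoly k)).coeFn_toLp] with x h₁ h₂
        rw [h₁, Pi.smul_apply, h₂, hermiteFunC, physHermiteC_eq_eval, smul_eq_mul, mul_assoc]
      have h0 := Submodule.inner_left_of_mem_orthogonal (Submodule.subset_span hu) hg
      rw [inner_smul_right, mul_eq_zero, or_iff_right (inv_ne_zero hc0), L2.inner_def] at h0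
      rw [← h0]
      refine integral_congr_ae ?_
      filter_upwards [(hpE (physHermitePoly k)).coeFn_toLp] with x hx
      rw [hx]
      rfl
    | zero => simp
    | add p q _ _ hp hq =>
      simp only [eval_add, add_mul]
      rw [integral_add (hint p) (hint q), hp, hq, add_zero]
    | smul c p _ hp =>
      simp only [eval_smul, smul_eq_mul, mul_assoc] at hp ⊢
      rw [integral_const_mul, hp, mul_zero]
  have hmom (n : ℕ) : ∫ x : ℝ, (x : ℂ) ^ n * (E x * star (g x)) = 0 := by
    rw [← horth ((X - C (a * Complex.I)) ^ n)]
    congr with x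
    rw [eval_pow, eval_sub, eval_X, eval_C, add_sub_cancel_right, mul_assoc]
  have hexp (c : ℝ) : Integrable fun x : ℝ => Real.exp (c * |x|) * ‖E x * star (g x)‖ := by
    have hm : MemLp (fun x : ℝ => (Real.exp (c * |x|) : ℂ) * E x) 2 (volume : Measure ℝ) := by
      refine memLp_two_of_norm_le_exp_mul_gaussian (M := Real.exp (a ^ 2 / 2)) (c := c)
        (by fun_prop) fun x => le_of_eq ?_
      rw [norm_mul, norm_cexp_neg_add_mul_I_sq_div_two, Complex.norm_real,
        Real.norm_of_nonneg (Real.exp_nonneg _)]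
      ring
    refine (hm.integrable_mul hgs).norm.congr (.of_forall fun x => ?_)
    simp only [Pi.mul_apply, norm_mul, Complex.norm_real, Real.norm_of_nonneg (Real.exp_nonneg _),
      mul_assoc]
  have hEg : Integrable fun x : ℝ => E x * star (g x) := by simpa using hint 1
  rw [Lp.eq_zero_iff_ae_eq_zero]
  filter_upwards [ae_eq_zero_of_fourier_eq_zero hEg
    (fourier_eq_zero_of_moments_eq_zero hexp hEg.aestronglyMeasurable hmom)] with x hx
  simpa [hE] using hx
end

section
/- Let a ∈ ℝ with a ≠ 0. There exist C > 0 and K ∈ ℕ such that for all k ≥ K, | 2·(2k)^{1/4}·√(|a|·π)·e^{-2^{3/2}|a|√k} · ∫_ℝ e^{2ax} h_k(x)² dx − 1 | ≤ C·k^{-1/2}. Equivalently, ∫_ℝ e^{2ax} h_k(x)² dx = (2(2k)^{1/4}√(|a|π))^{-1}·exp(2^{3/2}|a|√k)·(1 + O(k^{-1/2})) as k → ∞. -/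
open MeasureTheory

/-- The physicists' Hermite polynomial `H_k` on `ℝ`. -/
noncomputable def physHermiteR (k : ℕ) (x : ℝ) : ℝ :=
  (-1) ^ k * Real.exp (x ^ 2) * iteratedDeriv k (fun t : ℝ => Real.exp (-t ^ 2)) x

/-- The Hermite function `h_k` on `ℝ`. -/
noncomputable def hermiteFunR (k : ℕ) (x : ℝ) : ℝ :=
  (Real.sqrt (2 ^ k * Nat.factorial k * Real.sqrt Real.pi))⁻¹ *
    physHermiteR k x * Real.exp (-x ^ 2 / 2)

open Polynomial in
/-- The physicists' Hermite polynomials as elements of `ℝ[X]`. -/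
noncomputable def hermitePoly : ℕ → ℝ[X]
  | 0 => 1
  | k + 1 => 2 * X * hermitePoly k - derivative (hermitePoly k)

open Polynomial in
lemma derivative_hermitePoly (k : ℕ) :
    derivative (hermitePoly (k + 1)) = C (2 * ((k : ℝ) + 1)) * hermitePoly k := by
  induction k with
  | zero => simp [hermitePoly, ← C_ofNat]
  | succ k ih =>
    rw [hermitePoly, derivative_sub, derivative_mul, ih, derivative_C_mul]
    conv_rhs => rw [hermitePoly]
    conv_lhs => rw [hermitePoly]
    simp only [derivative_mul, derivative_ofNat, derivative_X, Nat.cast_add, Nat.cast_one,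
      map_mul, map_add, map_natCast, map_one, map_ofNat]
    ring

open Polynomial in
lemma iterate_derivative_hermitePoly (n m : ℕ) :
    derivative^[m] (hermitePoly (n + m)) =
      C (2 ^ m * ((n + m).factorial : ℝ) / (n.factorial : ℝ)) * hermitePoly n := by
  induction m with
  | zero =>
    have : (n.factorial : ℝ) ≠ 0 := by positivity
    simp [this]
  | succ m ih =>
    rw [Function.iterate_succ_apply, ← add_assoc, derivative_hermitePoly,
      iterate_derivative_C_mul, ih, ← mul_assoc, ← C_mul, Nat.factorial_succ]
    congr 2
    push_cast
    ring

lemma iteratedDeriv_exp_neg_sq (k : ℕ) (x : ℝ) :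
    iteratedDeriv k (fun t : ℝ => Real.exp (-t ^ 2)) x =
      (-1) ^ k * (hermitePoly k).eval x * Real.exp (-x ^ 2) := by
  induction k generalizing x with
  | zero => simp [hermitePoly]
  | succ k ih =>
    rw [iteratedDeriv_succ, funext ih]
    have h1 : HasDerivAt (fun t : ℝ => Real.exp (-t ^ 2)) (Real.exp (-x ^ 2) * (-(2 * x))) x := by
      have := ((hasDerivAt_pow 2 x).neg).exp
      simpa using this
    have h2 := (((hermitePoly k).hasDerivAt x).const_mul ((-1 : ℝ) ^ k)).mul h1
    refine h2.deriv.trans ?_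
    simp [hermitePoly]
    ring

lemma physHermiteR_eq_eval (k : ℕ) (x : ℝ) : physHermiteR k x = (hermitePoly k).eval x := by
  have h : Real.exp (x ^ 2) * Real.exp (-x ^ 2) = 1 := by
    rw [← Real.exp_add]; simp
  have h' : ((-1 : ℝ) ^ k) * (-1) ^ k = 1 := by
    rw [← mul_pow]; simp
  rw [physHermiteR, iteratedDeriv_exp_neg_sq]
  linear_combination (hermitePoly k).eval x * (-1 : ℝ) ^ k * (-1) ^ k * h +
    (hermitePoly k).eval x * h'

lemma integrable_eval_mul_exp_neg_sq (p : Polynomial ℝ) :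
    Integrable (fun x : ℝ => p.eval x * Real.exp (-x ^ 2)) := by
  induction p using Polynomial.induction_on' with
  | add p q hp hq =>
    refine (hp.add hq).congr (Filter.Eventually.of_forall fun x => ?_)
    simp [add_mul]
  | monomial n c =>
    have h := (integrable_rpow_mul_exp_neg_mul_sq (b := 1) one_pos (s := (n : ℝ))
      (by have : (0 : ℝ) ≤ n := n.cast_nonneg
          linarith)).const_mul c
    refine h.congr (Filter.Eventually.of_forall fun x => ?_)
    simp [mul_assoc]

lemma exp_two_mul_sub_sq (a x : ℝ) :
    Real.exp (2 * a * x - x ^ 2) = Real.exp (a ^ 2) * Real.exp (-(x - a) ^ 2) := by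
  rw [← Real.exp_add]; congr 1; ring

lemma integrable_eval_mul_exp (a : ℝ) (p : Polynomial ℝ) :
    Integrable (fun x : ℝ => p.eval x * Real.exp (2 * a * x - x ^ 2)) := by
  have h := ((integrable_eval_mul_exp_neg_sq
    (p.comp (Polynomial.X + Polynomial.C a))).comp_sub_right a).const_mul (Real.exp (a ^ 2))
  refine h.congr (Filter.Eventually.of_forall fun x => ?_)
  simp only [Polynomial.eval_comp, Polynomial.eval_add, Polynomial.eval_X, Polynomial.eval_C,
    sub_add_cancel, exp_two_mul_sub_sq]
  ring

/-- Integration of polynomials against the weight `exp (2ax - x²)`. -/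
noncomputable def gaussMoment (a : ℝ) : Polynomial ℝ →ₗ[ℝ] ℝ where
  toFun p := ∫ x : ℝ, p.eval x * Real.exp (2 * a * x - x ^ 2)
  map_add' p q := by
    rw [← integral_add (integrable_eval_mul_exp a p) (integrable_eval_mul_exp a q)]
    simp [add_mul]
  map_smul' c p := by
    rw [RingHom.id_apply, smul_eq_mul, ← integral_const_mul]
    simp [mul_assoc]

lemma gaussMoment_one (a : ℝ) :
    gaussMoment a 1 = Real.exp (a ^ 2) * Real.sqrt Real.pi := by
  have h := integral_gaussian 1
  simp only [div_one] at h
  simp only [gaussMoment, LinearMap.coe_mk, AddHom.coe_mk, Polynomial.eval_one, one_mul,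
    exp_two_mul_sub_sq, integral_const_mul]
  rw [integral_sub_right_eq_self (fun x : ℝ => Real.exp (-x ^ 2)) a, ← h]
  simp

open Polynomial in
lemma gaussMoment_by_parts (a : ℝ) (p : ℝ[X]) :
    gaussMoment a (derivative p + (C (2 * a) - 2 * X) * p) = 0 := by
  refine integral_eq_zero_of_hasDerivAt_of_integrable
    (f := fun x : ℝ => p.eval x * Real.exp (2 * a * x - x ^ 2)) (fun x => ?_)
    (integrable_eval_mul_exp a _) (integrable_eval_mul_exp a p)
  have h1 : HasDerivAt (fun x : ℝ => Real.exp (2 * a * x - x ^ 2))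
      (Real.exp (2 * a * x - x ^ 2) * (2 * a - 2 * x)) x := by
    have := (((hasDerivAt_id x).const_mul (2 * a)).sub (hasDerivAt_pow 2 x)).exp
    simpa using this
  refine ((p.hasDerivAt x).mul h1).congr_deriv ?_
  simp
  ring

open Polynomial in
lemma gaussMoment_mul_hermitePoly_succ (a : ℝ) (p : ℝ[X]) (k : ℕ) :
    gaussMoment a (p * hermitePoly (k + 1)) =
      gaussMoment a ((derivative + (2 * a) • LinearMap.id : ℝ[X] →ₗ[ℝ] ℝ[X]) p *
        hermitePoly k) := by
  have h := gaussMoment_by_parts a (p * hermitePoly k)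
  rw [← sub_eq_zero, ← neg_eq_zero, ← map_sub, ← map_neg, ← h]
  congr 1
  simp [hermitePoly, smul_eq_C_mul]
  ring

open Polynomial in
lemma gaussMoment_mul_hermitePoly (a : ℝ) (p : ℝ[X]) (k : ℕ) :
    gaussMoment a (p * hermitePoly k) =
      gaussMoment a (((derivative + (2 * a) • LinearMap.id : Module.End ℝ ℝ[X]) ^ k) p) := by
  induction k generalizing p with
  | zero => simp [hermitePoly]
  | succ k ih =>
    rw [gaussMoment_mul_hermitePoly_succ, ih, pow_succ, Module.End.mul_apply]

lemma gaussMoment_hermitePoly (a : ℝ) (k : ℕ) :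
    gaussMoment a (hermitePoly k) = (2 * a) ^ k * (Real.exp (a ^ 2) * Real.sqrt Real.pi) := by
  rw [← gaussMoment_one]
  induction k with
  | zero => simp [hermitePoly]
  | succ k ih =>
    have := gaussMoment_mul_hermitePoly_succ a 1 k
    rw [one_mul] at this
    rw [this]
    simp [ih]
    ring

open Polynomial in
lemma gaussMoment_hermitePoly_sq (a : ℝ) (k : ℕ) :
    gaussMoment a (hermitePoly k * hermitePoly k) =
      (2 ^ k * k.factorial * Real.sqrt Real.pi) * (Real.exp (a ^ 2) *
        ∑ j ∈ Finset.range (k + 1), (k.choose j : ℝ) * (2 * a ^ 2) ^ j / (j.factorial : ℝ)) := by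
  have hc : Commute ((2 * a) • LinearMap.id : Module.End ℝ ℝ[X])
      (derivative : Module.End ℝ ℝ[X]) := by
    refine LinearMap.ext fun p => ?_
    simp [Module.End.mul_apply]
  rw [gaussMoment_mul_hermitePoly, add_comm, hc.add_pow, LinearMap.sum_apply, map_sum,
    Finset.mul_sum, Finset.mul_sum]
  refine Finset.sum_congr rfl fun j hj => ?_
  obtain ⟨m, rfl⟩ := Nat.exists_eq_add_of_le (Nat.lt_succ_iff.mp (Finset.mem_range.mp hj))
  have hpow : ((2 * a) • LinearMap.id : Module.End ℝ ℝ[X]) ^ j =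
      ((2 * a) ^ j) • LinearMap.id := by
    rw [_root_.smul_pow]; congr 1; exact one_pow j
  have hnat : ∀ (n : ℕ) (p : ℝ[X]), ((n : Module.End ℝ ℝ[X])) p = (n : ℝ) • p := by
    intro n p
    simp [smul_eq_C_mul]
  rw [Nat.add_sub_cancel_left, hpow, Module.End.mul_apply, Module.End.mul_apply, hnat,
    LinearMap.smul_apply, LinearMap.id_apply, map_smul, Module.End.pow_apply,
    iterate_derivative_smul, iterate_derivative_hermitePoly, map_smul, ← smul_eq_C_mul, map_smul,
    gaussMoment_hermitePoly]
  have : (j.factorial : ℝ) ≠ 0 := by positivity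
  simp only [smul_eq_mul]
  field_simp
  ring

theorem integral_exp_mul_hermiteFunR_sq (a : ℝ) (k : ℕ) :
    ∫ x : ℝ, Real.exp (2 * a * x) * hermiteFunR k x ^ 2 =
      Real.exp (a ^ 2) *
        ∑ j ∈ Finset.range (k + 1), (k.choose j : ℝ) * (2 * a ^ 2) ^ j / (j.factorial : ℝ) := by
  have hpos : (0 : ℝ) < 2 ^ k * k.factorial * Real.sqrt Real.pi := by positivity
  have h : ∀ x : ℝ, Real.exp (2 * a * x) * hermiteFunR k x ^ 2 =
      (2 ^ k * k.factorial * Real.sqrt Real.pi)⁻¹ *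
        ((hermitePoly k * hermitePoly k).eval x * Real.exp (2 * a * x - x ^ 2)) := by
    intro x
    have he : Real.exp (2 * a * x - x ^ 2) =
        Real.exp (2 * a * x) * Real.exp (-x ^ 2 / 2) ^ 2 := by
      rw [← Real.exp_nat_mul, ← Real.exp_add]; congr 1; push_cast; ring
    rw [hermiteFunR, physHermiteR_eq_eval, he, mul_pow, mul_pow, inv_pow,
      Real.sq_sqrt hpos.le, Polynomial.eval_mul]
    ring
  simp_rw [h]
  rw [integral_const_mul]
  have := gaussMoment_hermitePoly_sq a k
  simp only [gaussMoment, LinearMap.coe_mk, AddHom.coe_mk] at this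
  rw [this, inv_mul_cancel_left₀ hpos.ne']

/-- The series `∑ y^j / (j!)²`, which equals the Bessel value `I₀(2√y)`. -/
noncomputable def besselSeries (y : ℝ) : ℝ := ∑' j : ℕ, y ^ j / (j.factorial : ℝ) ^ 2

lemma hasSum_besselSeries {y : ℝ} (hy : 0 ≤ y) :
    HasSum (fun j : ℕ => y ^ j / (j.factorial : ℝ) ^ 2) (besselSeries y) := by
  refine (Summable.of_nonneg_of_le (fun j => by positivity) (fun j => ?_)
    (Real.summable_pow_div_factorial y)).hasSum
  have h : (1 : ℝ) ≤ j.factorial := by exact_mod_cast Nat.one_le_iff_ne_zero.mpr j.factorial_ne_zero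
  gcongr
  nlinarith

lemma besselSeries_pos {y : ℝ} (hy : 0 ≤ y) : 0 < besselSeries y := by
  have h := sum_le_hasSum {0} (fun j _ => by positivity) (hasSum_besselSeries hy)
  simp at h
  linarith

lemma hasSum_of_eq {f g : ℕ → ℝ} {a b : ℝ} (h : HasSum f a) (hfg : ∀ j, g j = f j)
    (hab : b = a) : HasSum g b := by
  rwa [funext hfg, hab]

lemma bessel_weight_succ (y : ℝ) (j : ℕ) :
    (((j + 1 : ℕ) : ℝ)) ^ 2 * (y ^ (j + 1) / ((j + 1).factorial : ℝ) ^ 2) =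
      y * (y ^ j / (j.factorial : ℝ) ^ 2) := by
  have : (j.factorial : ℝ) ≠ 0 := by positivity
  have : ((j : ℝ) + 1) ≠ 0 := by positivity
  rw [Nat.factorial_succ, pow_succ y j]
  push_cast
  field_simp

lemma hasSum_sq_mul_bessel {y : ℝ} (hy : 0 ≤ y) :
    HasSum (fun j : ℕ => (j : ℝ) ^ 2 * (y ^ j / (j.factorial : ℝ) ^ 2))
      (y * besselSeries y) := by
  rw [← hasSum_nat_add_iff' 1]
  simp only [bessel_weight_succ]
  simpa using (hasSum_besselSeries hy).mul_left y

lemma exists_hasSum_mul_bessel {y s : ℝ} (hy : 0 ≤ y) (hs : 0 < s) :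
    ∃ M : ℝ, M ≤ (s + y / s) / 2 * besselSeries y ∧
      HasSum (fun j : ℕ => (j : ℝ) * (y ^ j / (j.factorial : ℝ) ^ 2)) M := by
  have hb : HasSum (fun j : ℕ => s / 2 * (y ^ j / (j.factorial : ℝ) ^ 2) +
      1 / (2 * s) * ((j : ℝ) ^ 2 * (y ^ j / (j.factorial : ℝ) ^ 2)))
      ((s + y / s) / 2 * besselSeries y) := by
    refine hasSum_of_eq (((hasSum_besselSeries hy).mul_left (s / 2)).add
      ((hasSum_sq_mul_bessel hy).mul_left (1 / (2 * s)))) (fun j => rfl) ?_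
    field_simp
  have hle : ∀ j : ℕ, (j : ℝ) * (y ^ j / (j.factorial : ℝ) ^ 2) ≤
      s / 2 * (y ^ j / (j.factorial : ℝ) ^ 2) +
      1 / (2 * s) * ((j : ℝ) ^ 2 * (y ^ j / (j.factorial : ℝ) ^ 2)) := by
    intro j
    have h1 : (j : ℝ) ≤ s / 2 + 1 / (2 * s) * (j : ℝ) ^ 2 := by
      have : s / 2 + 1 / (2 * s) * (j : ℝ) ^ 2 - j = (s - j) ^ 2 / (2 * s) := by
        field_simp; ring
      have h2 : 0 ≤ (s - j) ^ 2 / (2 * s) := by positivity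
      linarith
    have hw : 0 ≤ y ^ j / (j.factorial : ℝ) ^ 2 := by positivity
    nlinarith [mul_le_mul_of_nonneg_right h1 hw]
  have hsum := Summable.of_nonneg_of_le (fun j => by positivity) hle hb.summable
  exact ⟨_, hasSum_le hle hsum.hasSum hb, hsum.hasSum⟩

lemma hasSum_pow_four_mul_bessel {y M : ℝ} (hy : 0 ≤ y)
    (hM : HasSum (fun j : ℕ => (j : ℝ) * (y ^ j / (j.factorial : ℝ) ^ 2)) M) :
    HasSum (fun j : ℕ => (j : ℝ) ^ 4 * (y ^ j / (j.factorial : ℝ) ^ 2))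
      (y * (y * besselSeries y + 2 * M + besselSeries y)) := by
  rw [← hasSum_nat_add_iff' 1]
  refine hasSum_of_eq ((((hasSum_sq_mul_bessel hy).add (hM.mul_left 2)).add
    (hasSum_besselSeries hy)).mul_left y) (fun j => ?_) ?_
  · have h := bessel_weight_succ y j
    calc _ = (((j + 1 : ℕ) : ℝ)) ^ 2 * ((((j + 1 : ℕ) : ℝ)) ^ 2 *
          (y ^ (j + 1) / ((j + 1).factorial : ℝ) ^ 2)) := by ring
      _ = _ := by rw [h]; push_cast; ring
  · simp

lemma abs_exp_neg_sub_linear_le {u v : ℝ} (hu : 0 ≤ u) (hv : 0 ≤ v) :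
    |Real.exp (-u) - Real.exp (-v) * (1 - (u - v))| ≤ (u - v) ^ 2 := by
  have h1 := Real.add_one_le_exp (-(u - v))
  have h2 := Real.add_one_le_exp (u - v)
  have e1 : Real.exp (-v) * Real.exp (-(u - v)) = Real.exp (-u) := by
    rw [← Real.exp_add]; congr 1; ring
  have e2 : Real.exp (-u) * Real.exp (u - v) = Real.exp (-v) := by
    rw [← Real.exp_add]; congr 1; ring
  have pu := Real.exp_pos (-u)
  have pv := Real.exp_pos (-v)
  have lu : Real.exp (-u) ≤ 1 := Real.exp_le_one_iff.mpr (by linarith)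
  have lv : Real.exp (-v) ≤ 1 := Real.exp_le_one_iff.mpr (by linarith)
  have k1 := mul_le_mul_of_nonneg_left h1 pv.le
  have k2 := mul_le_mul_of_nonneg_left h2 pu.le
  rw [e1] at k1
  rw [e2] at k2
  rw [abs_of_nonneg (by linarith)]
  rcases le_total v u with h | h
  · nlinarith [mul_le_mul_of_nonneg_left k1 (sub_nonneg.mpr h),
      mul_le_mul_of_nonneg_right lv (sq_nonneg (u - v)), mul_nonneg (sub_nonneg.mpr h) pu.le]
  · nlinarith [mul_le_mul_of_nonneg_left k2 (sub_nonneg.mpr h),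
      mul_le_mul_of_nonneg_right lu (sq_nonneg (u - v)), mul_nonneg (sub_nonneg.mpr h) pv.le]

lemma abs_one_sub_max_sub_exp_le {k : ℕ} (hk : 0 < k) (j : ℕ) :
    |((k - j : ℕ) : ℝ) / k - Real.exp (-((2 * j + 1) / (2 * k)))| ≤
      1 / k + ((j + 1 : ℝ) / k) ^ 2 := by
  have hk' : (0 : ℝ) < k := by exact_mod_cast hk
  set s : ℝ := (2 * j + 1) / (2 * k) with hs
  have hs0 : 0 ≤ s := by positivity
  have hsle : s ≤ (j + 1 : ℝ) / k := by
    rw [hs, div_le_div_iff₀ (by positivity) hk']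
    nlinarith
  have hsq : s ^ 2 ≤ ((j + 1 : ℝ) / k) ^ 2 := by gcongr
  have hk1 : 0 < 1 / (k : ℝ) := by positivity
  rcases le_total j k with h | h
  · have h1 := abs_exp_neg_sub_linear_le hs0 le_rfl
    have e : ((k - j : ℕ) : ℝ) / k = 1 - s + 1 / k / 2 := by
      rw [Nat.cast_sub h, hs]; field_simp; ring
    rw [e]
    simp only [neg_zero, Real.exp_zero, sub_zero, one_mul] at h1
    rw [abs_le] at h1 ⊢
    constructor <;> linarith [h1.1, h1.2]
  · have h2 : 1 ≤ (j + 1 : ℝ) / k := by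
      rw [le_div_iff₀ hk']
      have : (k : ℝ) ≤ j := by exact_mod_cast h
      linarith
    have h3 : 1 ≤ ((j + 1 : ℝ) / k) ^ 2 := by nlinarith
    have h4 : Real.exp (-s) ≤ 1 := Real.exp_le_one_iff.mpr (by linarith)
    rw [Nat.sub_eq_zero_of_le h, Nat.cast_zero, zero_div, zero_sub, abs_neg,
      abs_of_pos (Real.exp_pos _)]
    linarith

lemma abs_descFactorial_div_sub_exp_le {k : ℕ} (hk : 0 < k) (j : ℕ) :
    |(k.descFactorial j : ℝ) / (k : ℝ) ^ j - Real.exp (-((j : ℝ) ^ 2 / (2 * k)))| ≤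
      (j : ℝ) / k + (j : ℝ) ^ 3 / (k : ℝ) ^ 2 := by
  have hk' : (0 : ℝ) < k := by exact_mod_cast hk
  induction j with
  | zero => simp
  | succ j ih =>
    have h1 := abs_one_sub_max_sub_exp_le hk j
    set t : ℝ := ((k - j : ℕ) : ℝ) / k with ht
    set e : ℝ := Real.exp (-((2 * j + 1) / (2 * k)))
    have ht0 : 0 ≤ t := by positivity
    have ht1 : t ≤ 1 := by
      rw [ht, div_le_one hk']
      exact_mod_cast Nat.sub_le k j
    have hf : (k.descFactorial (j + 1) : ℝ) / (k : ℝ) ^ (j + 1) =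
        t * ((k.descFactorial j : ℝ) / (k : ℝ) ^ j) := by
      rw [Nat.descFactorial_succ, ht, pow_succ]
      push_cast
      field_simp
    have hg : Real.exp (-(((j + 1 : ℕ) : ℝ) ^ 2 / (2 * k))) =
        e * Real.exp (-((j : ℝ) ^ 2 / (2 * k))) := by
      rw [← Real.exp_add]; congr 1; push_cast; field_simp; ring
    rw [hf, hg]
    set f := (k.descFactorial j : ℝ) / (k : ℝ) ^ j
    set g := Real.exp (-((j : ℝ) ^ 2 / (2 * k)))
    have hg0 : 0 < g := Real.exp_pos _
    have hg1 : g ≤ 1 := Real.exp_le_one_iff.mpr (by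
      have : 0 ≤ (j : ℝ) ^ 2 / (2 * k) := by positivity
      linarith)
    have hsplit : t * f - e * g = t * (f - g) + (t - e) * g := by ring
    calc |t * f - e * g| ≤ |t * (f - g)| + |(t - e) * g| := by rw [hsplit]; exact abs_add_le _ _
      _ = t * |f - g| + |t - e| * g := by rw [abs_mul, abs_mul, abs_of_nonneg ht0, abs_of_pos hg0]
      _ ≤ 1 * |f - g| + |t - e| * 1 := by gcongr
      _ ≤ ((j : ℝ) / k + (j : ℝ) ^ 3 / (k : ℝ) ^ 2) + (1 / k + ((j + 1 : ℝ) / k) ^ 2) := by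
        linarith
      _ ≤ _ := by
        have : ((j + 1 : ℕ) : ℝ) / k + ((j + 1 : ℕ) : ℝ) ^ 3 / (k : ℝ) ^ 2 -
          (((j : ℝ) / k + (j : ℝ) ^ 3 / (k : ℝ) ^ 2) + (1 / k + ((j + 1 : ℝ) / k) ^ 2)) =
          (2 * (j : ℝ) ^ 2 + j) / (k : ℝ) ^ 2 := by
          push_cast; field_simp; ring
        have h0 : 0 ≤ (2 * (j : ℝ) ^ 2 + j) / (k : ℝ) ^ 2 := by positivity
        linarith

lemma hasSum_descFactorial_mul_bessel {k : ℕ} (hk : 0 < k) (x : ℝ) :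
    HasSum (fun j : ℕ => (k.descFactorial j : ℝ) / (k : ℝ) ^ j *
        ((k * x) ^ j / (j.factorial : ℝ) ^ 2))
      (∑ j ∈ Finset.range (k + 1), (k.choose j : ℝ) * x ^ j / (j.factorial : ℝ)) := by
  have hk' : (k : ℝ) ≠ 0 := by positivity
  have he : ∀ j : ℕ, (k.descFactorial j : ℝ) / (k : ℝ) ^ j *
      ((k * x) ^ j / (j.factorial : ℝ) ^ 2) = (k.choose j : ℝ) * x ^ j / (j.factorial : ℝ) := by
    intro j
    have : (j.factorial : ℝ) ≠ 0 := by positivity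
    rw [Nat.descFactorial_eq_factorial_mul_choose, mul_pow]
    push_cast
    field_simp
  simp only [he]
  refine hasSum_sum_of_ne_finset_zero fun j hj => ?_
  rw [Nat.choose_eq_zero_of_lt (by simpa [Nat.lt_succ_iff] using hj)]
  simp

theorem abs_laguerreSum_sub_bessel_le {x : ℝ} (hx : 0 ≤ x) :
    ∃ C : ℝ, 0 ≤ C ∧ ∀ k : ℕ, 0 < k →
      |(∑ j ∈ Finset.range (k + 1), (k.choose j : ℝ) * x ^ j / (j.factorial : ℝ)) -
        Real.exp (-(x / 2)) * besselSeries (k * x)| ≤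
          C / Real.sqrt k * besselSeries (k * x) := by
  refine ⟨x * (2 + x) / 4 + (1 + x) / 2 + x / 2 + x * (2 * x + 2) / 2, by positivity,
    fun k hk => ?_⟩
  have hk1 : (1 : ℝ) ≤ k := by exact_mod_cast hk
  have hk0 : (0 : ℝ) < k := by linarith
  obtain ⟨s, hs, hks⟩ : ∃ s : ℝ, 1 ≤ s ∧ (k : ℝ) = s ^ 2 :=
    ⟨Real.sqrt k, Real.one_le_sqrt.mpr hk1, (Real.sq_sqrt hk0.le).symm⟩
  have hs0 : 0 < s := by linarith
  have hsqrt : Real.sqrt k = s := by rw [hks, Real.sqrt_sq hs0.le]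
  have hy : 0 ≤ (k : ℝ) * x := by positivity
  set B := besselSeries (k * x) with hB
  have hBpos : 0 < B := besselSeries_pos hy
  obtain ⟨M, hMle, hM⟩ := exists_hasSum_mul_bessel hy hs0
  rw [← hB] at hMle
  set w : ℕ → ℝ := fun j => ((k : ℝ) * x) ^ j / (j.factorial : ℝ) ^ 2 with hw
  have hw0 : ∀ j, 0 ≤ w j := fun j => by positivity
  have s0 : HasSum (fun j => w j) B := hasSum_besselSeries hy
  have s1 : HasSum (fun j : ℕ => (j : ℝ) * w j) M := hM
  have s2 : HasSum (fun j : ℕ => (j : ℝ) ^ 2 * w j) (k * x * B) := hasSum_sq_mul_bessel hy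
  have s4 : HasSum (fun j : ℕ => (j : ℝ) ^ 4 * w j) (k * x * (k * x * B + 2 * M + B)) :=
    hasSum_pow_four_mul_bessel hy hM
  have sd : HasSum (fun j : ℕ => (k.descFactorial j : ℝ) / (k : ℝ) ^ j * w j)
      (∑ j ∈ Finset.range (k + 1), (k.choose j : ℝ) * x ^ j / (j.factorial : ℝ)) :=
    hasSum_descFactorial_mul_bessel hk x
  have hmain : HasSum (fun j : ℕ => ((k.descFactorial j : ℝ) / (k : ℝ) ^ j -
      Real.exp (-(x / 2)) * (1 - ((j : ℝ) ^ 2 / (2 * k) - x / 2))) * w j)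
      ((∑ j ∈ Finset.range (k + 1), (k.choose j : ℝ) * x ^ j / (j.factorial : ℝ)) -
        Real.exp (-(x / 2)) * B) := by
    refine hasSum_of_eq (sd.sub ((s0.mul_left (Real.exp (-(x / 2)) * (1 + x / 2))).sub
      (s2.mul_left (Real.exp (-(x / 2)) / (2 * k))))) (fun j => ?_) ?_
    · field_simp
      ring
    · field_simp
      ring
  have hbound : HasSum (fun j : ℕ => (((j : ℝ) ^ 2 / (2 * k) - x / 2) ^ 2 +
      ((j : ℝ) / k + (s * (j : ℝ) ^ 2 + (j : ℝ) ^ 4 / s) / 2 / (k : ℝ) ^ 2)) * w j)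
      (x * (2 * M + B) / (4 * k) + (M / k +
        (s * (k * x * B) + k * x * (k * x * B + 2 * M + B) / s) / 2 / (k : ℝ) ^ 2)) := by
    refine hasSum_of_eq (((s4.mul_left (1 / (4 * (k : ℝ) ^ 2) + 1 / (2 * s * (k : ℝ) ^ 2))).add
      (s2.mul_left (s / (2 * (k : ℝ) ^ 2) - x / (2 * k)))).add
      ((s1.mul_left (1 / (k : ℝ))).add (s0.mul_left (x ^ 2 / 4)))) (fun j => ?_) ?_
    · field_simp
      ring
    · field_simp
      ring
  have hle : ∀ j : ℕ, |((k.descFactorial j : ℝ) / (k : ℝ) ^ j -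
      Real.exp (-(x / 2)) * (1 - ((j : ℝ) ^ 2 / (2 * k) - x / 2))) * w j| ≤
      (((j : ℝ) ^ 2 / (2 * k) - x / 2) ^ 2 +
      ((j : ℝ) / k + (s * (j : ℝ) ^ 2 + (j : ℝ) ^ 4 / s) / 2 / (k : ℝ) ^ 2)) * w j := by
    intro j
    rw [abs_mul, abs_of_nonneg (hw0 j)]
    refine mul_le_mul_of_nonneg_right ?_ (hw0 j)
    have h1 := abs_descFactorial_div_sub_exp_le hk j
    have h2 := abs_exp_neg_sub_linear_le (u := (j : ℝ) ^ 2 / (2 * k)) (v := x / 2)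
      (by positivity) (by positivity)
    have h3 : (j : ℝ) ^ 3 / (k : ℝ) ^ 2 ≤
        (s * (j : ℝ) ^ 2 + (j : ℝ) ^ 4 / s) / 2 / (k : ℝ) ^ 2 := by
      gcongr
      have : (s * (j : ℝ) ^ 2 + (j : ℝ) ^ 4 / s) / 2 - (j : ℝ) ^ 3 =
          (j : ℝ) ^ 2 * (s - j) ^ 2 / (2 * s) := by field_simp; ring
      have h0 : 0 ≤ (j : ℝ) ^ 2 * (s - j) ^ 2 / (2 * s) := by positivity
      linarith
    have h4 := abs_sub_le ((k.descFactorial j : ℝ) / (k : ℝ) ^ j)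
      (Real.exp (-((j : ℝ) ^ 2 / (2 * k))))
      (Real.exp (-(x / 2)) * (1 - ((j : ℝ) ^ 2 / (2 * k) - x / 2)))
    linarith
  have habs : |(∑ j ∈ Finset.range (k + 1), (k.choose j : ℝ) * x ^ j / (j.factorial : ℝ)) -
        Real.exp (-(x / 2)) * B| ≤ (x * (2 * M + B) / (4 * k) + (M / k +
        (s * (k * x * B) + k * x * (k * x * B + 2 * M + B) / s) / 2 / (k : ℝ) ^ 2)) := by
    rw [abs_le]
    exact ⟨neg_le.mp (hasSum_le (fun j => (neg_le_abs _).trans (hle j)) hmain.neg hbound),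
      hasSum_le (fun j => (le_abs_self _).trans (hle j)) hmain hbound⟩
  refine habs.trans ?_
  rw [hsqrt]
  have hM2 : M ≤ s * (1 + x) / 2 * B := by
    convert hMle using 2
    rw [hks]; field_simp
  have hM3 : 2 * M + B ≤ s * (2 + x) * B := by
    nlinarith [mul_nonneg (sub_nonneg.mpr hs) hBpos.le]
  have t1 : x * (2 * M + B) / (4 * k) ≤ x * (2 + x) / 4 / s * B := by
    calc _ ≤ x * (s * (2 + x) * B) / (4 * k) := by gcongr
      _ = _ := by rw [hks]; field_simp
  have t2 : M / k ≤ (1 + x) / 2 / s * B := by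
    calc _ ≤ s * (1 + x) / 2 * B / k := by gcongr
      _ = _ := by rw [hks]; field_simp
  have t3 : (s * (k * x * B) + k * x * (k * x * B + 2 * M + B) / s) / 2 / (k : ℝ) ^ 2 ≤
      (x / 2 + x * (2 * x + 2) / 2) / s * B := by
    have hs2 : s ≤ k := by rw [hks]; nlinarith
    have h5 : k * x * B + 2 * M + B ≤ k * (2 * x + 2) * B := by
      have : s * (2 + x) * B ≤ k * (2 + x) * B := by gcongr
      linarith
    calc _ ≤ (s * (k * x * B) + k * x * (k * (2 * x + 2) * B) / s) / 2 / (k : ℝ) ^ 2 := by gcongr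
      _ = _ := by rw [hks]; field_simp
  calc _ ≤ x * (2 + x) / 4 / s * B + ((1 + x) / 2 / s * B +
      (x / 2 + x * (2 * x + 2) / 2) / s * B) := by linarith
    _ = _ := by ring

lemma prod_range_wallis_div (n : ℕ) :
    (∏ i ∈ Finset.range n, (2 * (i : ℝ) + 1) / (2 * i + 2)) / ((2 * n).factorial : ℝ) =
      (1 / 4) ^ n / (n.factorial : ℝ) ^ 2 := by
  induction n with
  | zero => simp
  | succ n ih =>
    have h1 : ((2 * (n + 1)).factorial : ℝ) = (2 * n + 2) * ((2 * n + 1) * (2 * n).factorial) := by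
      rw [show 2 * (n + 1) = 2 * n + 1 + 1 by ring, Nat.factorial_succ, Nat.factorial_succ]
      push_cast; ring
    have h2 : ((2 * n).factorial : ℝ) ≠ 0 := by positivity
    have h3 : (n.factorial : ℝ) ≠ 0 := by positivity
    rw [div_eq_iff h2] at ih
    rw [Finset.prod_range_succ, ih, h1, Nat.factorial_succ]
    push_cast
    field_simp
    ring

theorem integral_cosh_mul_sin (z : ℝ) :
    ∫ θ in (0 : ℝ)..Real.pi, Real.cosh (z * Real.sin θ) =
      Real.pi * besselSeries (z ^ 2 / 4) := by
  have h := intervalIntegral.hasSum_integral_of_dominated_convergence (μ := volume)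
    (a := 0) (b := Real.pi)
    (F := fun (n : ℕ) (θ : ℝ) => (z * Real.sin θ) ^ (2 * n) / ((2 * n).factorial : ℝ))
    (f := fun θ => Real.cosh (z * Real.sin θ))
    (fun n _ => |z| ^ (2 * n) / ((2 * n).factorial : ℝ))
    (fun n => (by fun_prop : Continuous fun θ : ℝ =>
      (z * Real.sin θ) ^ (2 * n) / ((2 * n).factorial : ℝ)).aestronglyMeasurable)
    (fun n => Filter.Eventually.of_forall fun θ _ => by
      rw [Real.norm_eq_abs, abs_div, abs_pow, abs_mul, Nat.abs_cast]
      gcongr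
      exact mul_le_of_le_one_right (abs_nonneg z) (Real.abs_sin_le_one θ))
    (Filter.Eventually.of_forall fun θ _ => (Real.hasSum_cosh |z|).summable)
    (intervalIntegrable_const)
    (Filter.Eventually.of_forall fun θ _ => Real.hasSum_cosh _)
  refine h.unique ?_
  refine hasSum_of_eq ((hasSum_besselSeries (y := z ^ 2 / 4) (by positivity)).mul_left Real.pi)
    (fun n => ?_) rfl
  have e : ∀ θ : ℝ, (z * Real.sin θ) ^ (2 * n) / ((2 * n).factorial : ℝ) =
      z ^ (2 * n) / ((2 * n).factorial : ℝ) * Real.sin θ ^ (2 * n) := by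
    intro θ; rw [mul_pow]; ring
  simp only [e]
  rw [intervalIntegral.integral_const_mul, integral_sin_pow_even]
  have := prod_range_wallis_div n
  calc _ = Real.pi * z ^ (2 * n) * ((∏ i ∈ Finset.range n, (2 * (i : ℝ) + 1) / (2 * i + 2)) /
      ((2 * n).factorial : ℝ)) := by ring
    _ = _ := by rw [this, pow_mul, div_eq_mul_one_div (z ^ 2) 4, mul_pow]; ring

lemma abs_cos_sub_le (φ : ℝ) : |Real.cos φ - (1 - φ ^ 2 / 2)| ≤ φ ^ 4 := by
  rcases le_total |φ| 1 with h | h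
  · refine (Real.cos_bound h).trans ?_
    rw [show |φ| ^ 4 = φ ^ 4 from Even.pow_abs ⟨2, rfl⟩ φ]
    have : 0 ≤ φ ^ 4 := by positivity
    linarith
  · have h1 : 1 ≤ φ ^ 2 := by rw [← sq_abs]; nlinarith
    rw [abs_of_nonneg (by linarith [Real.one_sub_sq_div_two_le_cos (x := φ)])]
    nlinarith [Real.cos_le_one φ]

lemma two_div_pi_sq_lt_half : 2 / Real.pi ^ 2 < 1 / 2 := by
  rw [div_lt_div_iff₀ (by positivity) two_pos]
  nlinarith [Real.pi_gt_three]

lemma abs_exp_cos_sub_gaussian_le {z φ : ℝ} (hz : 0 ≤ z) (hφ : |φ| ≤ Real.pi) :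
    |Real.exp (z * (Real.cos φ - 1)) - Real.exp (-(z * φ ^ 2 / 2))| ≤
      z * (φ ^ 4 * Real.exp (-(2 / Real.pi ^ 2) * (z * φ ^ 2))) := by
  set p := z * (Real.cos φ - 1) with hp
  set q := -(z * φ ^ 2 / 2) with hq
  have hqp : q ≤ p := by
    have := mul_le_mul_of_nonneg_left (Real.one_sub_sq_div_two_le_cos (x := φ)) hz
    rw [hp, hq]; linarith
  have hd : p - q ≤ z * φ ^ 4 := by
    have := mul_le_mul_of_nonneg_left ((le_abs_self _).trans (abs_cos_sub_le φ)) hz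
    rw [hp, hq]; linarith
  have hpc : p ≤ -(2 / Real.pi ^ 2) * (z * φ ^ 2) := by
    have := mul_le_mul_of_nonneg_left (Real.cos_le_one_sub_mul_cos_sq hφ) hz
    rw [hp]; linarith
  rw [abs_of_nonneg (sub_nonneg.mpr (Real.exp_le_exp.mpr hqp))]
  have h1 : Real.exp p * Real.exp (q - p) = Real.exp q := by
    rw [← Real.exp_add]; congr 1; ring
  have h2 := mul_le_mul_of_nonneg_left (Real.add_one_le_exp (q - p)) (Real.exp_pos p).le
  calc Real.exp p - Real.exp q ≤ (p - q) * Real.exp p := by linarith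
    _ ≤ (z * φ ^ 4) * Real.exp (-(2 / Real.pi ^ 2) * (z * φ ^ 2)) := by
      gcongr
    _ = _ := by ring

lemma gaussian_le_of_one_le {z φ : ℝ} (hz : 1 ≤ z) (hφ : 1 ≤ |φ|) :
    Real.exp (-(z * φ ^ 2 / 2)) ≤
      z * (φ ^ 4 * Real.exp (-(2 / Real.pi ^ 2) * (z * φ ^ 2))) := by
  have h1 : 1 ≤ φ ^ 2 := by rw [← sq_abs]; nlinarith
  have h2 : 1 ≤ z * φ ^ 4 := by nlinarith [sq_nonneg (φ ^ 2 - 1)]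
  rw [← mul_assoc]
  refine le_trans (Real.exp_le_exp.mpr ?_) (le_mul_of_one_le_left (Real.exp_pos _).le h2)
  have h3 : 0 ≤ z * φ ^ 2 := by positivity
  nlinarith [mul_le_mul_of_nonneg_right two_div_pi_sq_lt_half.le h3]

/-- The fourth moment of the Gaussian weight `exp (-2u²/π²)`. -/
noncomputable def quarticGaussianMoment : ℝ :=
  ∫ u : ℝ, u ^ 4 * Real.exp (-(2 / Real.pi ^ 2) * u ^ 2)

lemma integrable_pow_four_mul_gaussian {c : ℝ} (hc : 0 < c) :
    Integrable fun u : ℝ => u ^ 4 * Real.exp (-c * u ^ 2) := by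
  have := integrable_rpow_mul_exp_neg_mul_sq hc (s := ((4 : ℕ) : ℝ)) (by norm_num)
  simpa only [Real.rpow_natCast] using this

lemma integral_pow_four_mul_gaussian {s : ℝ} (hs : 0 < s) :
    ∫ φ : ℝ, φ ^ 4 * Real.exp (-(2 / Real.pi ^ 2) * (s ^ 2 * φ ^ 2)) =
      quarticGaussianMoment / s ^ 5 := by
  have h := Measure.integral_comp_mul_left
    (fun u : ℝ => u ^ 4 * Real.exp (-(2 / Real.pi ^ 2) * u ^ 2)) s
  rw [abs_of_pos (inv_pos.mpr hs), smul_eq_mul] at h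
  rw [quarticGaussianMoment, eq_div_iff (by positivity)]
  rw [eq_inv_mul_iff_mul_eq₀ hs.ne'] at h
  rw [← h, ← integral_mul_const, ← integral_const_mul]
  congr 1
  funext φ
  rw [mul_pow s φ 2]
  ring

theorem abs_besselSeries_asymptotic_le :
    ∃ C : ℝ, 0 ≤ C ∧ ∀ z : ℝ, 1 ≤ z →
      |Real.sqrt (2 * Real.pi * z) * Real.exp (-z) * besselSeries (z ^ 2 / 4) - 1| ≤ C / z := by
  have hM : 0 ≤ quarticGaussianMoment := integral_nonneg fun u => by positivity
  refine ⟨Real.sqrt (2 * Real.pi) / (2 * Real.pi) * (quarticGaussianMoment + 2 * Real.pi),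
    by positivity, fun z hz => ?_⟩
  have hz0 : 0 < z := by linarith
  have hpi := Real.pi_pos
  obtain ⟨s, hs, rfl⟩ : ∃ s : ℝ, 1 ≤ s ∧ z = s ^ 2 :=
    ⟨Real.sqrt z, Real.one_le_sqrt.mpr hz, (Real.sq_sqrt hz0.le).symm⟩
  have hs0 : 0 < s := by linarith
  set z := s ^ 2 with hzdef
  set S : Set ℝ := Set.Ioc (-(Real.pi / 2)) (Real.pi / 2) with hS
  have hSm : MeasurableSet S := measurableSet_Ioc
  have hrep : Real.pi * besselSeries (z ^ 2 / 4) =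
      ∫ φ in S, Real.cosh (z * Real.cos φ) := by
    rw [← integral_cosh_mul_sin, hS, ← intervalIntegral.integral_of_le (by linarith)]
    have := intervalIntegral.integral_comp_add_right
      (a := -(Real.pi / 2)) (b := Real.pi / 2)
      (fun θ => Real.cosh (z * Real.sin θ)) (Real.pi / 2)
    simp only [Real.sin_add_pi_div_two] at this
    rw [this]
    congr 1 <;> ring
  have hint1 : Integrable (S.indicator fun φ => Real.exp (z * (Real.cos φ - 1))) := by
    rw [integrable_indicator_iff hSm]
    exact (Continuous.integrableOn_Icc (by fun_prop)).mono_set Set.Ioc_subset_Icc_self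
  have hint2 : Integrable (S.indicator fun φ => Real.exp (-(z * (1 + Real.cos φ)))) := by
    rw [integrable_indicator_iff hSm]
    exact (Continuous.integrableOn_Icc (by fun_prop)).mono_set Set.Ioc_subset_Icc_self
  have hint3 : Integrable fun φ : ℝ => Real.exp (-(z * φ ^ 2 / 2)) := by
    refine (integrable_exp_neg_mul_sq (b := z / 2) (by positivity)).congr
      (Filter.Eventually.of_forall fun φ => ?_)
    simp only
    congr 1; ring
  have hg : ∫ φ : ℝ, Real.exp (-(z * φ ^ 2 / 2)) = Real.sqrt (2 * Real.pi) / s := by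
    have h := integral_gaussian (z / 2)
    rw [show Real.pi / (z / 2) = 2 * Real.pi / s ^ 2 by rw [hzdef]; field_simp,
      Real.sqrt_div (by positivity), Real.sqrt_sq hs0.le] at h
    rw [← h]
    congr 1; funext φ; congr 1; ring
  have hsplit : 2 * Real.exp (-z) * (Real.pi * besselSeries (z ^ 2 / 4)) =
      (∫ φ, S.indicator (fun φ => Real.exp (z * (Real.cos φ - 1))) φ) +
        ∫ φ, S.indicator (fun φ => Real.exp (-(z * (1 + Real.cos φ)))) φ := by
    rw [hrep, ← integral_add hint1 hint2, ← integral_indicator hSm, ← integral_const_mul]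
    congr 1
    funext φ
    by_cases hφ : φ ∈ S
    · simp only [Set.indicator_of_mem hφ, Real.cosh_eq]
      rw [show z * (Real.cos φ - 1) = -z + z * Real.cos φ by ring,
        show -(z * (1 + Real.cos φ)) = -z + -(z * Real.cos φ) by ring, Real.exp_add, Real.exp_add]
      ring
    · simp [Set.indicator_of_notMem hφ]
  have hI1 : |(∫ φ, S.indicator (fun φ => Real.exp (z * (Real.cos φ - 1))) φ) -
      Real.sqrt (2 * Real.pi) / s| ≤ quarticGaussianMoment / s ^ 3 := by
    have hI : Integrable fun φ : ℝ =>
        z * (φ ^ 4 * Real.exp (-(2 / Real.pi ^ 2) * (z * φ ^ 2))) := by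
      refine ((integrable_pow_four_mul_gaussian (c := 2 / Real.pi ^ 2 * z)
        (by positivity)).const_mul z).congr (Filter.Eventually.of_forall fun φ => ?_)
      simp only
      congr 3; ring
    rw [← hg, ← integral_sub hint1 hint3, ← Real.norm_eq_abs]
    refine (norm_integral_le_of_norm_le hI (Filter.Eventually.of_forall fun φ => ?_)).trans_eq ?_
    · by_cases hφ : φ ∈ S
      · rw [Set.indicator_of_mem hφ, Real.norm_eq_abs]
        refine abs_exp_cos_sub_gaussian_le hz0.le (abs_le.mpr ⟨?_, ?_⟩) <;>
          linarith [hφ.1, hφ.2]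
      · rw [Set.indicator_of_notMem hφ, zero_sub, norm_neg, Real.norm_eq_abs,
          abs_of_pos (Real.exp_pos _)]
        refine gaussian_le_of_one_le hz ?_
        by_contra hlt
        obtain ⟨h1, h2⟩ := abs_lt.mp (not_le.mp hlt)
        exact hφ ⟨by linarith [Real.pi_gt_three], by linarith [Real.pi_gt_three]⟩
    · rw [integral_const_mul, hzdef, integral_pow_four_mul_gaussian hs0]
      field_simp
  have hexp : Real.exp (-z) ≤ 2 / s ^ 3 := by
    have h1 := Real.quadratic_le_exp_of_nonneg hz0.le
    rw [Real.exp_neg, inv_eq_one_div, div_le_div_iff₀ (Real.exp_pos _) (by positivity)]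
    have h2 : s ^ 3 ≤ z ^ 2 := by
      rw [hzdef, ← pow_mul]; exact pow_le_pow_right₀ hs (by norm_num)
    nlinarith
  have hI2 : |∫ φ, S.indicator (fun φ => Real.exp (-(z * (1 + Real.cos φ)))) φ| ≤
      2 * Real.pi / s ^ 3 := by
    rw [integral_indicator hSm, ← Real.norm_eq_abs]
    have := norm_setIntegral_le_of_norm_le_const (μ := volume) (s := S) (C := Real.exp (-z))
      (f := fun φ => Real.exp (-(z * (1 + Real.cos φ)))) (by simp [hS]) (fun φ hφ => by
        rw [Real.norm_eq_abs, abs_of_pos (Real.exp_pos _)]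
        refine Real.exp_le_exp.mpr ?_
        have := Real.cos_nonneg_of_neg_pi_div_two_le_of_le hφ.1.le hφ.2
        nlinarith [mul_nonneg hz0.le this])
    refine this.trans ?_
    have hv : volume.real S = Real.pi := by
      rw [hS, Real.volume_real_Ioc_of_le (by linarith)]; ring
    rw [hv]
    calc Real.exp (-z) * Real.pi ≤ 2 / s ^ 3 * Real.pi := by gcongr
      _ = _ := by ring
  have hroot : Real.sqrt (2 * Real.pi * z) = Real.sqrt (2 * Real.pi) * s := by
    rw [hzdef, Real.sqrt_mul (by positivity), Real.sqrt_sq hs0.le]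
  set r := Real.sqrt (2 * Real.pi) with hr
  have hr0 : 0 < r := Real.sqrt_pos.mpr (by positivity)
  have hr2 : r * r = 2 * Real.pi := Real.mul_self_sqrt (by positivity)
  set I1 := ∫ φ, S.indicator (fun φ => Real.exp (z * (Real.cos φ - 1))) φ
  set I2 := ∫ φ, S.indicator (fun φ => Real.exp (-(z * (1 + Real.cos φ)))) φ
  have key : r * s * Real.exp (-z) * besselSeries (z ^ 2 / 4) - 1 =
      r * s / (2 * Real.pi) * ((I1 - r / s) + I2) := by
    have : r * s * Real.exp (-z) * besselSeries (z ^ 2 / 4) =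
        r * s / (2 * Real.pi) * (2 * Real.exp (-z) * (Real.pi * besselSeries (z ^ 2 / 4))) := by
      field_simp
    rw [this, hsplit]
    have h2 : r * s / (2 * Real.pi) * (r / s) = 1 := by
      rw [← hr2]; field_simp
    linear_combination h2
  rw [hroot, key, abs_mul, abs_of_pos (by positivity : 0 < r * s / (2 * Real.pi))]
  calc r * s / (2 * Real.pi) * |I1 - r / s + I2| ≤
      r * s / (2 * Real.pi) * (quarticGaussianMoment / s ^ 3 + 2 * Real.pi / s ^ 3) := by
        gcongr
        exact (abs_add_le _ _).trans (add_le_add hI1 hI2)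
    _ = _ := by rw [hzdef]; field_simp

/-- Asymptotics of the spectral projection norms:
`∫ e^{2ax} h_k(x)² dx = (2 (2k)^{1/4} √(|a|π))⁻¹ exp(2^{3/2}|a|√k) (1 + O(k^{-1/2}))`. -/
theorem stmt_7 (a : ℝ) (ha : a ≠ 0) :
    ∃ C : ℝ, 0 < C ∧ ∃ K : ℕ, ∀ k : ℕ, K ≤ k →
      |2 * (2 * (k : ℝ)) ^ ((1 : ℝ) / 4) * Real.sqrt (|a| * Real.pi) *
          Real.exp (-(2 ^ ((3 : ℝ) / 2) * |a| * Real.sqrt k)) *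
          (∫ x : ℝ, Real.exp (2 * a * x) * hermiteFunR k x ^ 2) - 1|
        ≤ C * (k : ℝ) ^ (-(1 : ℝ) / 2) := by
  obtain ⟨C₁, hC₁, h₁⟩ := abs_laguerreSum_sub_bessel_le (x := 2 * a ^ 2) (by positivity)
  obtain ⟨C₂, hC₂, h₂⟩ := abs_besselSeries_asymptotic_le
  have ha' : 0 < |a| := abs_pos.mpr ha
  have ha2 : 0 < a ^ 2 := by positivity
  set c : ℝ := 2 ^ ((3 : ℝ) / 2) * |a| with hc
  have hc0 : 0 < c := by positivity
  have hc2 : c ^ 2 = 8 * a ^ 2 := by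
    rw [hc, mul_pow, sq_abs, ← Real.rpow_natCast, ← Real.rpow_mul two_pos.le]
    norm_num
  set E := Real.exp (a ^ 2) with hE
  have hE0 : 0 < E := Real.exp_pos _
  refine ⟨C₂ / c * (1 + E * C₁) + E * C₁ + 1, by positivity, max 1 ⌈1 / a ^ 2⌉₊,
    fun k hk => ?_⟩
  have hkpos : 0 < k := lt_of_lt_of_le one_pos ((le_max_left _ _).trans hk)
  have hk1 : (1 : ℝ) ≤ k := by exact_mod_cast hkpos
  have hk0 : (0 : ℝ) < k := by linarith
  have hka : 1 ≤ k * a ^ 2 := by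
    rw [← div_le_iff₀ ha2]
    exact (Nat.le_ceil _).trans (by exact_mod_cast (le_max_right _ _).trans hk)
  obtain ⟨s, hs0, hks, hsqrt⟩ : ∃ s : ℝ, 0 < s ∧ (k : ℝ) = s ^ 2 ∧ Real.sqrt k = s :=
    ⟨Real.sqrt k, Real.sqrt_pos.mpr hk0, (Real.sq_sqrt hk0.le).symm, rfl⟩
  have hs1 : 1 ≤ s := by
    rw [← hsqrt]; exact Real.one_le_sqrt.mpr hk1
  have hrpow : (k : ℝ) ^ (-(1 : ℝ) / 2) = 1 / s := by
    rw [neg_div, Real.rpow_neg hk0.le, ← Real.sqrt_eq_rpow, hsqrt, one_div]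
  have hz1 : 1 ≤ c * s := by
    refine (sq_le_sq₀ zero_le_one (by positivity)).mp ?_
    rw [mul_pow, hc2, ← hks]
    linarith
  have hz : (c * s) ^ 2 / 4 = k * (2 * a ^ 2) := by
    rw [mul_pow, hc2, hks]; ring
  have h₁ := h₁ k hkpos
  have h₂ := h₂ (c * s) hz1
  have hpre : 2 * (2 * (k : ℝ)) ^ ((1 : ℝ) / 4) * Real.sqrt (|a| * Real.pi) =
      Real.sqrt (2 * Real.pi * (c * s)) := by
    refine (Real.sqrt_eq_iff_mul_self_eq (by positivity) (by positivity)).mpr ?_ |>.symm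
    have e1 : (2 * (k : ℝ)) ^ ((1 : ℝ) / 4) * (2 * (k : ℝ)) ^ ((1 : ℝ) / 4) =
        Real.sqrt 2 * s := by
      rw [← Real.rpow_add (by positivity), ← hsqrt, ← Real.sqrt_mul two_pos.le,
        Real.sqrt_eq_rpow]
      norm_num
    have e2 : (2 : ℝ) ^ ((3 : ℝ) / 2) = 2 * Real.sqrt 2 := by
      rw [Real.sqrt_eq_rpow, show (3 : ℝ) / 2 = 1 + 1 / 2 by norm_num,
        Real.rpow_add two_pos, Real.rpow_one]
    have e3 : Real.sqrt (|a| * Real.pi) * Real.sqrt (|a| * Real.pi) = |a| * Real.pi :=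
      Real.mul_self_sqrt (by positivity)
    rw [hc, e2]
    linear_combination -4 * (Real.sqrt (|a| * Real.pi) * Real.sqrt (|a| * Real.pi)) * e1 -
      4 * Real.sqrt 2 * s * e3
  rw [integral_exp_mul_hermiteFunR_sq, hpre, hrpow, hsqrt, ← hE]
  rw [hz] at h₂
  rw [hsqrt] at h₁
  set B := besselSeries (k * (2 * a ^ 2)) with hB
  have hB0 : 0 < B := besselSeries_pos (by positivity)
  set S := ∑ j ∈ Finset.range (k + 1), (k.choose j : ℝ) * (2 * a ^ 2) ^ j / (j.factorial : ℝ)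
  set R := Real.sqrt (2 * Real.pi * (c * s)) * Real.exp (-(c * s)) * B with hR
  have hEinv : E * Real.exp (-(2 * a ^ 2 / 2)) = 1 := by
    rw [hE, ← Real.exp_add, Real.exp_eq_one_iff]; ring
  have hr : |E * S / B - 1| ≤ E * C₁ / s := by
    have e : E * S / B - 1 = E / B * (S - Real.exp (-(2 * a ^ 2 / 2)) * B) := by
      generalize Real.exp (-(2 * a ^ 2 / 2)) = q at hEinv ⊢
      field_simp
      linear_combination B * hEinv
    rw [e, abs_mul, abs_of_pos (by positivity : 0 < E / B)]
    calc _ ≤ E / B * (C₁ / s * B) := by gcongr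
      _ = _ := by field_simp
  have hr' : |E * S / B| ≤ 1 + E * C₁ := by
    have h3 : E * C₁ / s ≤ E * C₁ := div_le_self (by positivity) hs1
    have h4 := abs_add_le (E * S / B - 1) 1
    rw [sub_add_cancel, abs_one] at h4
    linarith
  have hprod : Real.sqrt (2 * Real.pi * (c * s)) * Real.exp (-(c * s)) * (E * S) - 1 =
      (R - 1) * (E * S / B) + (E * S / B - 1) := by
    rw [hR]; field_simp; ring
  rw [hprod]
  calc |(R - 1) * (E * S / B) + (E * S / B - 1)|
      ≤ |R - 1| * |E * S / B| + |E * S / B - 1| := by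
        rw [← abs_mul]; exact abs_add_le _ _
    _ ≤ C₂ / (c * s) * (1 + E * C₁) + E * C₁ / s := by gcongr
    _ = (C₂ / c * (1 + E * C₁) + E * C₁) * (1 / s) := by field_simp
    _ ≤ _ := by
        exact mul_le_mul_of_nonneg_right (by linarith) (by positivity)
end

section
/- Let β > 2 and let α be a real number with α < 1 + β/2. Let p : ℝ → ℝ be twice continuously differentiable, and suppose there is M > 0 with |p(x)| ≤ M(1+x²)^{α/2}, |p'(x)| ≤ M(1+x²)^{(α−1)/2}, and |p''(x)| ≤ M(1+x²)^{(α−2)/2} for all x ∈ ℝ. Set s = 1/2 + max((α−1)/β, 0); note s < 1. Then there exists C > 0 such that for every Schwartz function f : ℝ → ℂ, ‖x ↦ (p''(x) − p'(x)²)·f(x) + 2p'(x)·f'(x)‖ ≤ C·‖x ↦ -f''(x) + |x|^β·f(x) + f(x)‖^{s}·‖f‖^{1−s}. -/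
open MeasureTheory

/-- The `L²(ℝ)` norm of a function `f : ℝ → ℂ`. -/
noncomputable def L2N (f : ℝ → ℂ) : ℝ := (∫ x : ℝ, ‖f x‖ ^ 2) ^ ((1 : ℝ) / 2)

open scoped SchwartzMap RealInnerProductSpace

/-- The weight `1 + |x|^β`, the potential of `T + 1`. -/
noncomputable def potential (β x : ℝ) : ℝ := 1 + |x| ^ β

lemma one_le_potential (β x : ℝ) : 1 ≤ potential β x :=
  le_add_of_nonneg_right (Real.rpow_nonneg (abs_nonneg x) β)

lemma potential_pos (β x : ℝ) : 0 < potential β x :=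
  zero_lt_one.trans_le (one_le_potential β x)

lemma continuous_potential_rpow {β : ℝ} (hβ : 0 ≤ β) (t : ℝ) :
    Continuous fun x => potential β x ^ t := by
  unfold potential
  refine Continuous.rpow_const ?_ fun x => Or.inl (potential_pos β x).ne'
  exact continuous_const.add (continuous_abs.rpow_const fun x => Or.inr hβ)

lemma abs_rpow_le_one_add_pow_ceil {β : ℝ} (hβ : 0 ≤ β) (x : ℝ) :
    |x| ^ β ≤ 1 + |x| ^ ⌈β⌉₊ := by
  rcases le_total |x| 1 with h | h
  · have := Real.rpow_le_one (abs_nonneg x) h hβ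
    have := pow_nonneg (abs_nonneg x) ⌈β⌉₊
    linarith
  · have := Real.rpow_le_rpow_of_exponent_le h (Nat.le_ceil β)
    rw [Real.rpow_natCast] at this
    linarith

lemma potential_sq_le {β : ℝ} (hβ : 0 ≤ β) (x : ℝ) :
    potential β x ^ 2 ≤ 8 + 2 * |x| ^ (2 * ⌈β⌉₊) := by
  have h := abs_rpow_le_one_add_pow_ceil hβ x
  have h1 := one_le_potential β x
  rw [mul_comm 2 ⌈β⌉₊, pow_mul]
  unfold potential at *
  nlinarith [sq_nonneg (|x| ^ ⌈β⌉₊ - 2)]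

lemma integrable_mul_inner {β K : ℝ} (hβ : 0 ≤ β) {W : ℝ → ℝ} (hW : Continuous W)
    (hK : ∀ x, |W x| ≤ K * potential β x ^ 2) (g h : 𝓢(ℝ, ℂ)) :
    Integrable fun x => W x * ⟪g x, h x⟫ := by
  have hK0 : 0 ≤ K := by
    have h0 := (abs_nonneg _).trans (hK 0)
    exact nonneg_of_mul_nonneg_left h0 (pow_pos (potential_pos β 0) 2)
  set S := SchwartzMap.seminorm ℝ 0 0 h
  have hS : 0 ≤ S := apply_nonneg _ _
  have hint : Integrable fun x : ℝ =>
      (K * S) * (8 * ‖g x‖ + 2 * (‖x‖ ^ (2 * ⌈β⌉₊) * ‖g x‖)) :=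
    ((g.integrable.norm.const_mul 8).add
      ((g.integrable_pow_mul volume (2 * ⌈β⌉₊)).const_mul 2)).const_mul _
  refine hint.mono' (hW.mul (g.continuous.inner h.continuous)).aestronglyMeasurable
    (Filter.Eventually.of_forall fun x => ?_)
  rw [norm_mul, Real.norm_eq_abs, Real.norm_eq_abs, Real.norm_eq_abs]
  have h1 : |⟪g x, h x⟫| ≤ ‖g x‖ * S :=
    (abs_real_inner_le_norm _ _).trans
      (mul_le_mul_of_nonneg_left (SchwartzMap.norm_le_seminorm ℝ h x) (norm_nonneg _))
  calc |W x| * |⟪g x, h x⟫|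
      ≤ (K * (8 + 2 * |x| ^ (2 * ⌈β⌉₊))) * (‖g x‖ * S) := by
        refine mul_le_mul ((hK x).trans ?_) h1 (abs_nonneg _) (by positivity)
        exact mul_le_mul_of_nonneg_left (potential_sq_le hβ x) hK0
    _ = _ := by ring

lemma potential_rpow_le_sq (β x : ℝ) {t : ℝ} (ht : t ≤ 2) :
    |potential β x ^ t| ≤ 1 * potential β x ^ 2 := by
  rw [one_mul, abs_of_nonneg (Real.rpow_nonneg (potential_pos β x).le t)]
  exact_mod_cast Real.rpow_le_rpow_of_exponent_le (one_le_potential β x) ht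

lemma integrable_potential_rpow_mul_inner {β t : ℝ} (hβ : 0 ≤ β) (ht : t ≤ 2)
    (g h : 𝓢(ℝ, ℂ)) : Integrable fun x => potential β x ^ t * ⟪g x, h x⟫ :=
  integrable_mul_inner hβ (continuous_potential_rpow hβ t)
    (fun x => potential_rpow_le_sq β x ht) g h

lemma integrable_potential_rpow_mul_norm_sq {β t : ℝ} (hβ : 0 ≤ β) (ht : t ≤ 2)
    (g : 𝓢(ℝ, ℂ)) : Integrable fun x => potential β x ^ t * ‖g x‖ ^ 2 := by
  simpa only [real_inner_self_eq_norm_sq] using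
    integrable_potential_rpow_mul_inner hβ ht g g

lemma integrable_norm_sq (g : 𝓢(ℝ, ℂ)) : Integrable fun x => ‖g x‖ ^ 2 := by
  simpa using integrable_potential_rpow_mul_norm_sq zero_le_one zero_le_two g (t := 0)

/-- Integration by parts for `∫ V^θ |f'|²`, where `V = 1 + |x|^β`. -/
lemma exists_integral_potential_rpow_mul_norm_deriv_sq {β θ : ℝ} (hβ : 2 < β) (hθ : 0 ≤ θ)
    (hθ2 : θ ≤ 2) {f g k : 𝓢(ℝ, ℂ)} (hg : ∀ x, HasDerivAt f (g x) x)
    (hk : ∀ x, HasDerivAt g (k x) x) :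
    ∃ W : ℝ → ℝ, (∀ x, |W x| ≤ θ * β * potential β x ^ θ) ∧
      Integrable (fun x => W x * ⟪f x, g x⟫) ∧
      ∫ x, potential β x ^ θ * ‖g x‖ ^ 2 =
        -(∫ x, potential β x ^ θ * ⟪f x, k x⟫) - ∫ x, W x * ⟪f x, g x⟫ := by
  have hβ0 : 0 ≤ β := by linarith
  set W : ℝ → ℝ := fun x => (β * |x| ^ (β - 2) * x) * θ * potential β x ^ (θ - 1) with hWdef
  have hWd (x : ℝ) : HasDerivAt (fun x => potential β x ^ θ) (W x) x :=
    ((hasDerivAt_abs_rpow x (by linarith : 1 < β)).const_add 1).rpow_const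
      (Or.inl (potential_pos β x).ne')
  have hWc : Continuous W := by
    refine Continuous.mul ?_ (continuous_potential_rpow hβ0 _)
    have : Continuous fun x : ℝ => |x| ^ (β - 2) :=
      continuous_abs.rpow_const fun x => Or.inr (by linarith)
    fun_prop
  have hWb (x : ℝ) : |W x| ≤ θ * β * potential β x ^ θ := by
    have hV := potential_pos β x
    have h1 : |x| ^ (β - 2) * |x| ≤ potential β x := by
      rcases le_total |x| 1 with h | h
      · have := Real.rpow_le_one (abs_nonneg x) h (by linarith : 0 ≤ β - 2)
        have := mul_le_one₀ this (abs_nonneg x) h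
        linarith [one_le_potential β x]
      · have h0 : 0 < |x| := by linarith
        rw [← Real.rpow_add_one h0.ne']
        have := Real.rpow_le_rpow_of_exponent_le h (by linarith : β - 2 + 1 ≤ β)
        unfold potential
        linarith
    have h2 : |W x| = θ * β * (|x| ^ (β - 2) * |x|) * potential β x ^ (θ - 1) := by
      simp only [hWdef, abs_mul, abs_of_nonneg hβ0, abs_of_nonneg hθ,
        abs_of_nonneg (Real.rpow_nonneg (abs_nonneg x) _), abs_of_nonneg (Real.rpow_nonneg hV.le _)]
      ring
    have h3 : potential β x ^ θ = potential β x * potential β x ^ (θ - 1) := by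
      rw [mul_comm, ← Real.rpow_add_one hV.ne', sub_add_cancel]
    rw [h2, h3, ← mul_assoc (θ * β) (potential β x)]
    exact mul_le_mul_of_nonneg_right (mul_le_mul_of_nonneg_left h1 (mul_nonneg hθ hβ0))
      (Real.rpow_nonneg hV.le _)
  have hWi : Integrable (fun x => W x * ⟪f x, g x⟫) := by
    refine integrable_mul_inner (β := β) (K := θ * β) hβ0 hWc (fun x => (hWb x).trans ?_) f g
    refine mul_le_mul_of_nonneg_left ?_ (mul_nonneg hθ hβ0)
    simpa using (le_abs_self _).trans (potential_rpow_le_sq β x hθ2)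
  have i1 := integrable_potential_rpow_mul_inner hβ0 hθ2 f k
  have i2 := integrable_potential_rpow_mul_norm_sq hβ0 hθ2 g
  have i12 : Integrable fun x => potential β x ^ θ * ⟪f x, k x⟫ + potential β x ^ θ * ‖g x‖ ^ 2 :=
    i1.add i2
  refine ⟨W, hWb, hWi, ?_⟩
  have hd (x : ℝ) : HasDerivAt (fun x => potential β x ^ θ * ⟪f x, g x⟫)
      (W x * ⟪f x, g x⟫ +
        (potential β x ^ θ * ⟪f x, k x⟫ + potential β x ^ θ * ‖g x‖ ^ 2)) x := by
    have h := (hWd x).mul ((hg x).inner ℝ (hk x))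
    rwa [real_inner_self_eq_norm_sq, mul_add] at h
  have key := integral_eq_zero_of_hasDerivAt_of_integrable hd (hWi.add i12)
    (integrable_potential_rpow_mul_inner hβ0 hθ2 f g)
  rw [integral_add hWi i12, integral_add i1 i2] at key
  linarith

/-- Expansion of `‖-k + (1 + |x|^β) f‖²`. -/
lemma norm_sq_neg_add_potential_mul (β x : ℝ) (z w : ℂ) :
    ‖-w + ((|x| ^ β : ℝ) : ℂ) * z + z‖ ^ 2 =
      ‖w‖ ^ 2 - 2 * (potential β x * ⟪z, w⟫) + potential β x ^ 2 * ‖z‖ ^ 2 := by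
  have h : -w + ((|x| ^ β : ℝ) : ℂ) * z + z = potential β x • z - w := by
    rw [Complex.real_smul, potential]
    push_cast
    ring
  rw [h, norm_sub_sq_real, norm_smul, real_inner_smul_left, Real.norm_eq_abs, mul_pow, sq_abs]
  ring

lemma potential_mul_norm_sq_sub_inner_le (β x : ℝ) (z w : ℂ) :
    potential β x * ‖z‖ ^ 2 - ⟪z, w⟫ ≤
      1 / 2 * (potential β x * ‖z‖ ^ 2) +
        1 / 2 * ‖-w + ((|x| ^ β : ℝ) : ℂ) * z + z‖ ^ 2 := by
  set h := -w + ((|x| ^ β : ℝ) : ℂ) * z + z with hh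
  have h1 : potential β x * ‖z‖ ^ 2 - ⟪z, w⟫ = ⟪z, h⟫ := by
    have : h = potential β x • z - w := by
      rw [hh, Complex.real_smul, potential]
      push_cast
      ring
    rw [this, inner_sub_right, real_inner_smul_right, real_inner_self_eq_norm_sq]
  have h2 := real_inner_le_norm z h
  have h3 := one_le_potential β x
  rw [h1]
  nlinarith [sq_nonneg (‖z‖ - ‖h‖), sq_nonneg ‖z‖]

section Estimates

variable {β : ℝ} {f g k : 𝓢(ℝ, ℂ)}

lemma integrable_norm_sq_neg_add_potential_mul (hβ : 0 ≤ β) (f k : 𝓢(ℝ, ℂ)) :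
    Integrable fun x => ‖-(k x) + ((|x| ^ β : ℝ) : ℂ) * f x + f x‖ ^ 2 := by
  simp only [norm_sq_neg_add_potential_mul]
  have h1 := integrable_potential_rpow_mul_inner hβ one_le_two f k
  have h2 := integrable_potential_rpow_mul_norm_sq hβ le_rfl f
  simp only [Real.rpow_one, Real.rpow_two] at h1 h2
  exact ((integrable_norm_sq k).sub (h1.const_mul 2)).add h2

/-- The quadratic form of `T + 1` is controlled by `‖(T + 1) f‖²`. -/
lemma form_le (hβ : 2 < β) (hg : ∀ x, HasDerivAt f (g x) x) (hk : ∀ x, HasDerivAt g (k x) x) :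
    (∫ x, potential β x * ‖f x‖ ^ 2) + 2 * ∫ x, ‖g x‖ ^ 2 ≤
      ∫ x, ‖-(k x) + ((|x| ^ β : ℝ) : ℂ) * f x + f x‖ ^ 2 := by
  have hβ0 : 0 ≤ β := by linarith
  obtain ⟨W, hW, -, hibp⟩ :=
    exists_integral_potential_rpow_mul_norm_deriv_sq hβ le_rfl zero_le_two hg hk
  have hW0 (x : ℝ) : W x = 0 := by simpa using hW x
  simp only [hW0, Real.rpow_zero, one_mul, zero_mul, integral_zero, sub_zero] at hibp
  have i1 := integrable_potential_rpow_mul_norm_sq hβ0 one_le_two f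
  have i2 := integrable_potential_rpow_mul_inner hβ0 zero_le_two f k
  simp only [Real.rpow_zero, Real.rpow_one, one_mul] at i1 i2
  have i3 := integrable_norm_sq_neg_add_potential_mul hβ0 f k
  have h := integral_mono (i1.sub i2) ((i1.const_mul (1 / 2)).add (i3.const_mul (1 / 2)))
    fun x => potential_mul_norm_sq_sub_inner_le β x (f x) (k x)
  rw [integral_sub' i1 i2, integral_add' (i1.const_mul _) (i3.const_mul _),
    integral_const_mul, integral_const_mul] at h
  linarith

/-- Separation: `‖f''‖` and `‖(1 + |x|^β) f‖` are controlled by `‖(T + 1) f‖`. -/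
lemma separation (hβ : 2 < β) (hg : ∀ x, HasDerivAt f (g x) x)
    (hk : ∀ x, HasDerivAt g (k x) x) :
    (∫ x, ‖k x‖ ^ 2) + ∫ x, potential β x ^ 2 * ‖f x‖ ^ 2 ≤
      (1 + β ^ 2 / 2) * ∫ x, ‖-(k x) + ((|x| ^ β : ℝ) : ℂ) * f x + f x‖ ^ 2 := by
  have hβ0 : 0 ≤ β := by linarith
  obtain ⟨W, hW, hWi, hibp⟩ :=
    exists_integral_potential_rpow_mul_norm_deriv_sq hβ zero_le_one one_le_two hg hk
  simp only [Real.rpow_one, one_mul] at hW hibp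
  have i1 := integrable_potential_rpow_mul_norm_sq hβ0 one_le_two f
  have i2 := integrable_potential_rpow_mul_inner hβ0 one_le_two f k
  have i3 := integrable_potential_rpow_mul_norm_sq hβ0 le_rfl f
  have i4 := integrable_potential_rpow_mul_norm_sq hβ0 one_le_two g
  simp only [Real.rpow_one, Real.rpow_two] at i1 i2 i3 i4
  have i5 := integrable_norm_sq k
  have hcross : -(∫ x, W x * ⟪f x, g x⟫) ≤
      (∫ x, potential β x * ‖g x‖ ^ 2) + β ^ 2 / 4 * ∫ x, potential β x * ‖f x‖ ^ 2 := by
    rw [← integral_neg, ← integral_const_mul, ← integral_add i4 (i1.const_mul _)]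
    refine integral_mono hWi.neg (i4.add (i1.const_mul _)) fun x => ?_
    have hV := potential_pos β x
    calc -(W x * ⟪f x, g x⟫) ≤ |W x| * |⟪f x, g x⟫| := by
          rw [← abs_mul]; exact neg_le_abs _
      _ ≤ (β * potential β x) * (‖f x‖ * ‖g x‖) :=
          mul_le_mul (hW x) (abs_real_inner_le_norm _ _) (abs_nonneg _) (by positivity)
      _ ≤ _ := by
          nlinarith [mul_nonneg hV.le (sq_nonneg (‖g x‖ - β / 2 * ‖f x‖))]
  have hP : ∫ x, ‖-(k x) + ((|x| ^ β : ℝ) : ℂ) * f x + f x‖ ^ 2 =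
      (∫ x, ‖k x‖ ^ 2) - 2 * (∫ x, potential β x * ⟪f x, k x⟫) +
        ∫ x, potential β x ^ 2 * ‖f x‖ ^ 2 := by
    simp only [norm_sq_neg_add_potential_mul]
    have i52 : Integrable fun x => ‖k x‖ ^ 2 - 2 * (potential β x * ⟪f x, k x⟫) :=
      i5.sub (i2.const_mul 2)
    rw [integral_add i52 i3, integral_sub i5 (i2.const_mul 2), integral_const_mul]
  have hform := form_le hβ hg hk
  have hg0 : 0 ≤ ∫ x, ‖g x‖ ^ 2 := integral_nonneg fun x => sq_nonneg _
  have hb : β ^ 2 / 2 * (∫ x, potential β x * ‖f x‖ ^ 2) ≤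
      β ^ 2 / 2 * ∫ x, ‖-(k x) + ((|x| ^ β : ℝ) : ℂ) * f x + f x‖ ^ 2 :=
    mul_le_mul_of_nonneg_left (by linarith) (by positivity)
  linarith

/-- Hölder's inequality for a weighted geometric mean of two nonnegative functions. -/
lemma integral_rpow_mul_rpow_le {u v : ℝ → ℝ} (hu : ∀ x, 0 ≤ u x) (hv : ∀ x, 0 ≤ v x)
    (iu : Integrable u) (iv : Integrable v) (pu : 0 < ∫ x, u x) (pv : 0 < ∫ x, v x)
    {θ : ℝ} (hθ : 0 ≤ θ) (hθ1 : θ ≤ 1) :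
    ∫ x, u x ^ θ * v x ^ (1 - θ) ≤ (∫ x, u x) ^ θ * (∫ x, v x) ^ (1 - θ) := by
  set A := ∫ x, u x with hA
  set B := ∫ x, v x with hB
  have hpt (x : ℝ) : u x ^ θ * v x ^ (1 - θ) ≤
      A ^ θ * B ^ (1 - θ) * (θ / A * u x + (1 - θ) / B * v x) := by
    have h := Real.geom_mean_le_arith_mean2_weighted hθ (by linarith : 0 ≤ 1 - θ)
      (div_nonneg (hu x) pu.le) (div_nonneg (hv x) pv.le) (by ring)
    rw [Real.div_rpow (hu x) pu.le, Real.div_rpow (hv x) pv.le, div_mul_div_comm,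
      div_le_iff₀ (by positivity)] at h
    refine h.trans (le_of_eq ?_)
    ring
  have hi : Integrable fun x => θ / A * u x + (1 - θ) / B * v x :=
    (iu.const_mul _).add (iv.const_mul _)
  refine (integral_mono_of_nonneg (Filter.Eventually.of_forall fun x => ?_)
    (hi.const_mul (A ^ θ * B ^ (1 - θ))) (Filter.Eventually.of_forall hpt)).trans_eq ?_
  · exact mul_nonneg (Real.rpow_nonneg (hu x) _) (Real.rpow_nonneg (hv x) _)
  · rw [integral_const_mul, integral_add (iu.const_mul _) (iv.const_mul _),
      integral_const_mul, integral_const_mul, ← hA, ← hB, div_mul_cancel₀ _ pu.ne',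
      div_mul_cancel₀ _ pv.ne', add_sub_cancel, mul_one]

lemma integral_norm_sq_le_integral_potential_mul {t : ℝ} (hβ : 0 ≤ β) (ht : 0 ≤ t)
    (ht2 : t ≤ 2) (f : 𝓢(ℝ, ℂ)) :
    ∫ x, ‖f x‖ ^ 2 ≤ ∫ x, potential β x ^ t * ‖f x‖ ^ 2 :=
  integral_mono (integrable_norm_sq f) (integrable_potential_rpow_mul_norm_sq hβ ht2 f) fun x =>
    le_mul_of_one_le_left (sq_nonneg _) (Real.one_le_rpow (one_le_potential β x) ht)

lemma integral_potential_rpow_two_mul_le {θ : ℝ} (hβ : 0 ≤ β) (hθ : 0 ≤ θ) (hθ1 : θ ≤ 1)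
    (hf : 0 < ∫ x, ‖f x‖ ^ 2) :
    ∫ x, potential β x ^ (2 * θ) * ‖f x‖ ^ 2 ≤
      (∫ x, potential β x ^ 2 * ‖f x‖ ^ 2) ^ θ * (∫ x, ‖f x‖ ^ 2) ^ (1 - θ) := by
  have i := integrable_potential_rpow_mul_norm_sq hβ le_rfl f
  have hp := integral_norm_sq_le_integral_potential_mul hβ zero_le_two le_rfl f
  simp only [Real.rpow_two] at i hp
  refine le_trans (le_of_eq ?_) (integral_rpow_mul_rpow_le (fun x => by positivity)
    (fun x => by positivity) i (integrable_norm_sq f) (hf.trans_le hp) hf hθ hθ1)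
  congr 1
  ext x
  rw [Real.mul_rpow (by positivity) (by positivity), mul_assoc,
    ← Real.rpow_add_of_nonneg (by positivity) hθ (by linarith), add_sub_cancel, Real.rpow_one,
    Real.rpow_mul (potential_pos β x).le, Real.rpow_two]

lemma integral_potential_rpow_mul_norm_deriv_sq_le {θ l : ℝ} (hβ : 2 < β) (hθ : 0 ≤ θ)
    (hθ1 : θ ≤ 1) (hl : 0 < l) (hg : ∀ x, HasDerivAt f (g x) x)
    (hk : ∀ x, HasDerivAt g (k x) x) :
    ∫ x, potential β x ^ θ * ‖g x‖ ^ 2 ≤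
      ((∫ x, ‖k x‖ ^ 2) + β * ∫ x, ‖g x‖ ^ 2) / (2 * l) +
        (1 + β) * l / 2 * ∫ x, potential β x ^ (2 * θ) * ‖f x‖ ^ 2 := by
  have hβ0 : 0 ≤ β := by linarith
  obtain ⟨W, hW, hWi, hibp⟩ :=
    exists_integral_potential_rpow_mul_norm_deriv_sq hβ hθ (by linarith) hg hk
  have i1 := integrable_potential_rpow_mul_inner hβ0 (by linarith : θ ≤ 2) f k
  have i2 := integrable_potential_rpow_mul_norm_sq hβ0 (by linarith : 2 * θ ≤ 2) f
  have i3 := integrable_norm_sq k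
  have i4 := (integrable_norm_sq g).const_mul β
  have i34 : Integrable fun x => (‖k x‖ ^ 2 + β * ‖g x‖ ^ 2) / (2 * l) := (i3.add i4).div_const _
  have i1n : Integrable fun x => -(potential β x ^ θ * ⟪f x, k x⟫) := i1.neg
  rw [hibp, ← integral_neg, ← integral_sub i1n hWi, ← integral_const_mul,
    ← integral_const_mul, ← integral_add i3 i4, ← integral_div,
    ← integral_add i34 (i2.const_mul _)]
  refine integral_mono (i1n.sub hWi) (i34.add (i2.const_mul _)) fun x => ?_
  have hV := potential_pos β x
  set a := potential β x ^ θ with ha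
  have ha0 : 0 ≤ a := Real.rpow_nonneg hV.le _
  have ha2 : potential β x ^ (2 * θ) = a ^ 2 := by
    rw [ha, mul_comm, Real.rpow_mul hV.le, Real.rpow_two]
  have young (b : ℝ) : (a * ‖f x‖) * b ≤ b ^ 2 / (2 * l) + l / 2 * (a ^ 2 * ‖f x‖ ^ 2) := by
    have : b ^ 2 / (2 * l) + l / 2 * (a ^ 2 * ‖f x‖ ^ 2) - (a * ‖f x‖) * b =
        (b - l * (a * ‖f x‖)) ^ 2 / (2 * l) := by
      field_simp
      ring
    have : 0 ≤ (b - l * (a * ‖f x‖)) ^ 2 / (2 * l) := by positivity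
    linarith
  have h1 : -(a * ⟪f x, k x⟫) ≤ (a * ‖f x‖) * ‖k x‖ := by
    rw [mul_assoc, ← mul_neg]
    exact mul_le_mul_of_nonneg_left ((neg_le_abs _).trans (abs_real_inner_le_norm _ _)) ha0
  have h2 : -(W x * ⟪f x, g x⟫) ≤ β * ((a * ‖f x‖) * ‖g x‖) :=
    calc -(W x * ⟪f x, g x⟫) ≤ |W x| * |⟪f x, g x⟫| := by
          rw [← abs_mul]; exact neg_le_abs _
      _ ≤ (β * a) * (‖f x‖ * ‖g x‖) := by
          refine mul_le_mul ((hW x).trans ?_) (abs_real_inner_le_norm _ _) (abs_nonneg _)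
            (by positivity)
          exact mul_le_mul_of_nonneg_right (mul_le_of_le_one_left hβ0 hθ1) ha0
      _ = _ := by ring
  have h3 := young ‖k x‖
  have h4 := mul_le_mul_of_nonneg_left (young ‖g x‖) hβ0
  calc -(a * ⟪f x, k x⟫) - W x * ⟪f x, g x⟫
      ≤ (‖k x‖ ^ 2 / (2 * l) + l / 2 * (a ^ 2 * ‖f x‖ ^ 2)) +
        β * (‖g x‖ ^ 2 / (2 * l) + l / 2 * (a ^ 2 * ‖f x‖ ^ 2)) := by linarith
    _ = (‖k x‖ ^ 2 + β * ‖g x‖ ^ 2) / (2 * l) +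
        (1 + β) * l / 2 * (potential β x ^ (2 * θ) * ‖f x‖ ^ 2) := by
      rw [ha2]; ring

/-- The weighted norms of `f` and `f'` are interpolated between `‖(T + 1) f‖` and `‖f‖`. -/
lemma weighted_norms_le {θ : ℝ} (hβ : 2 < β) (hθ : 0 ≤ θ) (hθ1 : θ ≤ 1)
    (hg : ∀ x, HasDerivAt f (g x) x) (hk : ∀ x, HasDerivAt g (k x) x)
    (hf : 0 < ∫ x, ‖f x‖ ^ 2) :
    (∫ x, potential β x ^ (2 * θ) * ‖f x‖ ^ 2) + ∫ x, potential β x ^ θ * ‖g x‖ ^ 2 ≤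
      ((1 + β ^ 2 / 2) * (3 + β) + β) *
        ((∫ x, ‖-(k x) + ((|x| ^ β : ℝ) : ℂ) * f x + f x‖ ^ 2) ^ ((1 + θ) / 2) *
          (∫ x, ‖f x‖ ^ 2) ^ ((1 - θ) / 2)) := by
  have hβ0 : 0 ≤ β := by linarith
  have hform := form_le hβ hg hk
  have hsep := separation hβ hg hk
  have hholder := integral_potential_rpow_two_mul_le (f := f) hβ0 hθ hθ1 hf
  have hQV := integral_norm_sq_le_integral_potential_mul hβ0 zero_le_one one_le_two f
  have hg0 : 0 ≤ ∫ x, ‖g x‖ ^ 2 := integral_nonneg fun x => sq_nonneg _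
  have hk0 : 0 ≤ ∫ x, ‖k x‖ ^ 2 := integral_nonneg fun x => sq_nonneg _
  have hV0 : 0 ≤ ∫ x, potential β x ^ 2 * ‖f x‖ ^ 2 := integral_nonneg fun x => by positivity
  simp only [Real.rpow_one] at hQV
  set P := ∫ x, ‖-(k x) + ((|x| ^ β : ℝ) : ℂ) * f x + f x‖ ^ 2
  set Q := ∫ x, ‖f x‖ ^ 2
  set c := 1 + β ^ 2 / 2 with hc
  have hc1 : 1 ≤ c := by rw [hc]; linarith [sq_nonneg β]
  have hQP : Q ≤ P := by linarith
  have hP : 0 < P := hf.trans_le hQP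
  set μ := (1 - θ) / 2 with hμ
  have hμ0 : 0 ≤ μ := by rw [hμ]; linarith
  set p := P ^ μ
  set q := Q ^ μ
  have hp : 0 < p := Real.rpow_pos_of_pos hP _
  have hq : 0 < q := Real.rpow_pos_of_pos hf _
  have hqp : q ≤ p := Real.rpow_le_rpow hf.le hQP hμ0
  set r := P ^ θ
  have hr : 0 < r := Real.rpow_pos_of_pos hP _
  have hPr : P = r * p * p := by
    rw [← Real.rpow_add hP, ← Real.rpow_add hP, hμ]
    ring_nf
    rw [Real.rpow_one]
  have hPq : P ^ ((1 + θ) / 2) = r * p := by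
    rw [← Real.rpow_add hP, hμ]
    ring_nf
  have hQq : Q ^ (1 - θ) = q * q := by
    rw [← Real.rpow_add hf, hμ]
    ring_nf
  have hcr : (∫ x, potential β x ^ 2 * ‖f x‖ ^ 2) ^ θ ≤ c * r := by
    have : ∫ x, potential β x ^ 2 * ‖f x‖ ^ 2 ≤ c * P := by linarith
    refine (Real.rpow_le_rpow hV0 this hθ).trans ?_
    rw [Real.mul_rpow (by linarith) hP.le]
    exact mul_le_mul_of_nonneg_right (Real.rpow_le_self_of_one_le hc1 hθ1) hr.le
  have hS : ∫ x, potential β x ^ (2 * θ) * ‖f x‖ ^ 2 ≤ c * r * (q * q) := by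
    rw [hQq] at hholder
    exact hholder.trans (mul_le_mul_of_nonneg_right hcr (by positivity))
  have hE := integral_potential_rpow_mul_norm_deriv_sq_le hβ hθ hθ1 (div_pos hp hq) hg hk
  have hE1 : ((∫ x, ‖k x‖ ^ 2) + β * ∫ x, ‖g x‖ ^ 2) / (2 * (p / q)) ≤
      (c + β) / 2 * (r * p * q) := by
    have : ((∫ x, ‖k x‖ ^ 2) + β * ∫ x, ‖g x‖ ^ 2) ≤ (c + β) * P := by
      have := mul_le_mul_of_nonneg_left (by linarith : (∫ x, ‖g x‖ ^ 2) ≤ P) hβ0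
      linarith
    rw [div_le_iff₀ (by positivity)]
    refine this.trans_eq ?_
    rw [hPr]
    field_simp
  have hE2 : (1 + β) * (p / q) / 2 * ∫ x, potential β x ^ (2 * θ) * ‖f x‖ ^ 2 ≤
      (1 + β) * c / 2 * (r * p * q) := by
    refine (mul_le_mul_of_nonneg_left hS (by positivity)).trans_eq ?_
    field_simp
  have hS1 : c * r * (q * q) ≤ c * (r * p * q) := by
    have := mul_le_mul_of_nonneg_left hqp (by positivity : 0 ≤ c * r * q)
    linarith
  have hR : 0 ≤ r * p * q := by positivity
  rw [hPq]
  have : (c + β) / 2 * (r * p * q) + (1 + β) * c / 2 * (r * p * q) + c * (r * p * q) ≤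
      (c * (3 + β) + β) * (r * p * q) := by
    rw [← add_mul, ← add_mul]
    refine mul_le_mul_of_nonneg_right ?_ hR
    nlinarith [mul_nonneg (by linarith : 0 ≤ c) hβ0]
  linarith

end Estimates

lemma one_add_sq_le_potential_rpow {β : ℝ} (hβ : 0 < β) (x : ℝ) :
    1 + x ^ 2 ≤ 2 * potential β x ^ (2 / β) := by
  have h1 : 1 ≤ potential β x ^ (2 / β) :=
    Real.one_le_rpow (one_le_potential β x) (by positivity)
  have h2 : x ^ 2 ≤ potential β x ^ (2 / β) := by
    have h : (|x| ^ β) ^ (2 / β) = x ^ 2 := by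
      rw [← Real.rpow_mul (abs_nonneg x), mul_div_cancel₀ _ hβ.ne', Real.rpow_two, sq_abs]
    rw [← h]
    refine Real.rpow_le_rpow (by positivity) ?_ (by positivity)
    unfold potential
    linarith
  linarith

lemma one_add_sq_rpow_le_potential_rpow {β a t : ℝ} (hβ : 0 < β) (ht : 0 ≤ t)
    (ha : a ≤ β * t / 2) (x : ℝ) :
    (1 + x ^ 2) ^ a ≤ 2 ^ (β * t / 2) * potential β x ^ t := by
  have hx : 1 ≤ 1 + x ^ 2 := by linarith [sq_nonneg x]
  have hV := potential_pos β x
  calc (1 + x ^ 2) ^ a ≤ (1 + x ^ 2) ^ (β * t / 2) := Real.rpow_le_rpow_of_exponent_le hx ha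
    _ ≤ (2 * potential β x ^ (2 / β)) ^ (β * t / 2) :=
        Real.rpow_le_rpow (by linarith) (one_add_sq_le_potential_rpow hβ x) (by positivity)
    _ = 2 ^ (β * t / 2) * potential β x ^ t := by
        rw [Real.mul_rpow zero_le_two (by positivity), ← Real.rpow_mul hV.le]
        congr 2
        field_simp

lemma norm_perturbation_sq_le {a b c u v : ℝ} (ha : |a| ≤ c * u ^ 2) (hb : |b| ≤ c * u)
    (hu : v = u ^ 2) (z w : ℂ) :
    ‖((a - b ^ 2 : ℝ) : ℂ) * z + 2 * (b : ℂ) * w‖ ^ 2 ≤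
      (2 * (c + c ^ 2) ^ 2 + 8 * c ^ 2) * (v ^ 2 * ‖z‖ ^ 2 + v * ‖w‖ ^ 2) := by
  have hb2 : b ^ 2 ≤ (c * u) ^ 2 := sq_le_sq' (by linarith [neg_abs_le b]) ((le_abs_self b).trans hb)
  have h1 : |a - b ^ 2| ≤ (c + c ^ 2) * u ^ 2 := by
    refine (abs_sub _ _).trans ?_
    rw [abs_of_nonneg (sq_nonneg b)]
    linarith
  have h2 : ‖((a - b ^ 2 : ℝ) : ℂ) * z + 2 * (b : ℂ) * w‖ ≤ |a - b ^ 2| * ‖z‖ + 2 * |b| * ‖w‖ := by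
    refine (norm_add_le _ _).trans (le_of_eq ?_)
    simp only [norm_mul, Complex.norm_real, Real.norm_eq_abs, Complex.norm_ofNat]
  have h3 : |a - b ^ 2| ^ 2 ≤ ((c + c ^ 2) * u ^ 2) ^ 2 := pow_le_pow_left₀ (abs_nonneg _) h1 2
  calc _ ≤ (|a - b ^ 2| * ‖z‖ + 2 * |b| * ‖w‖) ^ 2 := pow_le_pow_left₀ (norm_nonneg _) h2 2
    _ ≤ 2 * (|a - b ^ 2| ^ 2 * ‖z‖ ^ 2) + 8 * (b ^ 2 * ‖w‖ ^ 2) := by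
        have := sq_nonneg (|a - b ^ 2| * ‖z‖ - 2 * |b| * ‖w‖)
        rw [sub_sq, mul_pow, mul_pow, mul_pow, sq_abs b] at this
        rw [add_sq, mul_pow, mul_pow, mul_pow, sq_abs b]
        linarith
    _ ≤ 2 * (((c + c ^ 2) * u ^ 2) ^ 2 * ‖z‖ ^ 2) + 8 * ((c * u) ^ 2 * ‖w‖ ^ 2) := by gcongr
    _ ≤ _ := by
        have e1 : 0 ≤ c ^ 2 * (u ^ 2) ^ 2 * ‖z‖ ^ 2 := by positivity
        have e2 : 0 ≤ (c + c ^ 2) ^ 2 * u ^ 2 * ‖w‖ ^ 2 := by positivity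
        rw [hu]
        linarith

lemma L2N_le_of_integral_le {b h f : ℝ → ℂ} {c s : ℝ} (hc : 0 ≤ c)
    (hb : ∫ x, ‖b x‖ ^ 2 ≤ c * ((∫ x, ‖h x‖ ^ 2) ^ s * (∫ x, ‖f x‖ ^ 2) ^ (1 - s))) :
    L2N b ≤ c ^ ((1 : ℝ) / 2) * L2N h ^ s * L2N f ^ (1 - s) := by
  have hb0 : 0 ≤ ∫ x, ‖b x‖ ^ 2 := integral_nonneg fun x => sq_nonneg _
  have hh0 : 0 ≤ ∫ x, ‖h x‖ ^ 2 := integral_nonneg fun x => sq_nonneg _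
  have hf0 : 0 ≤ ∫ x, ‖f x‖ ^ 2 := integral_nonneg fun x => sq_nonneg _
  unfold L2N
  refine (Real.rpow_le_rpow hb0 hb (by norm_num)).trans_eq ?_
  rw [Real.mul_rpow hc (by positivity), Real.mul_rpow (by positivity) (by positivity),
    ← Real.rpow_mul hh0, ← Real.rpow_mul hf0, ← Real.rpow_mul hh0, ← Real.rpow_mul hf0,
    mul_comm s, mul_comm (1 - s), mul_assoc]

lemma integral_norm_sq_pos {f : 𝓢(ℝ, ℂ)} (hf : f ≠ 0) : 0 < ∫ x, ‖f x‖ ^ 2 := by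
  refine (integral_nonneg fun x => sq_nonneg _).lt_of_ne' fun h => hf ?_
  rw [integral_eq_zero_iff_of_nonneg (fun x => sq_nonneg _) (integrable_norm_sq f)] at h
  have h0 := Continuous.ae_eq_iff_eq volume (f.continuous.norm.pow 2) continuous_zero |>.mp h
  ext x
  simpa using congrFun h0 x

/-- The perturbation `B = p'' − (p')² + 2ip'D` is `s`-subordinated to `T + 1`, where
`T = -d²/dx² + |x|^β` and `s = 1/2 + max((α−1)/β, 0)`. -/
theorem stmt_11 (β α : ℝ) (hβ : 2 < β) (hα : α < 1 + β / 2)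
    (p : ℝ → ℝ) (hp : ContDiff ℝ 2 p) (M : ℝ) (hM : 0 < M)
    (hp0 : ∀ x : ℝ, |p x| ≤ M * (1 + x ^ 2) ^ (α / 2))
    (hp1 : ∀ x : ℝ, |deriv p x| ≤ M * (1 + x ^ 2) ^ ((α - 1) / 2))
    (hp2 : ∀ x : ℝ, |deriv (deriv p) x| ≤ M * (1 + x ^ 2) ^ ((α - 2) / 2)) :
    ∃ C : ℝ, 0 < C ∧
      ∀ f : SchwartzMap ℝ ℂ,
        L2N (fun x : ℝ => ((deriv (deriv p) x - deriv p x ^ 2 : ℝ) : ℂ) * f x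
              + 2 * ((deriv p x : ℝ) : ℂ) * deriv (⇑f) x)
          ≤ C * L2N (fun x : ℝ => -(deriv (deriv ⇑f) x) + ((|x| ^ β : ℝ) : ℂ) * f x + f x)
                  ^ (1 / 2 + max ((α - 1) / β) 0)
              * L2N ⇑f ^ (1 - (1 / 2 + max ((α - 1) / β) 0)) := by
  have hβ0 : 0 < β := by linarith
  set m := max ((α - 1) / β) 0 with hm
  have hm0 : 0 ≤ m := le_max_right _ _
  have hαm : α - 1 ≤ β * m := by
    have := le_max_left ((α - 1) / β) 0
    rw [div_le_iff₀ hβ0] at this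
    linarith
  have hm1 : 2 * m ≤ 1 := by
    have : m ≤ 1 / 2 := max_le (by rw [div_le_iff₀ hβ0]; linarith) (by norm_num)
    linarith
  set c := M * 2 ^ (β * (2 * m) / 2) with hc
  have hc0 : 0 < c := by positivity
  have hb (x : ℝ) : |deriv p x| ≤ c * potential β x ^ m := by
    refine (hp1 x).trans ?_
    rw [hc, mul_assoc]
    refine mul_le_mul_of_nonneg_left ?_ hM.le
    refine (one_add_sq_rpow_le_potential_rpow hβ0 hm0 (by linarith) x).trans ?_
    refine mul_le_mul_of_nonneg_right ?_ (Real.rpow_nonneg (potential_pos β x).le _)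
    exact Real.rpow_le_rpow_of_exponent_le one_le_two (by nlinarith)
  have ha (x : ℝ) : |deriv (deriv p) x| ≤ c * (potential β x ^ m) ^ 2 := by
    refine (hp2 x).trans ?_
    rw [hc, mul_assoc, ← Real.rpow_two (potential β x ^ m), ← Real.rpow_mul (potential_pos β x).le, mul_comm m 2]
    exact mul_le_mul_of_nonneg_left
      (one_add_sq_rpow_le_potential_rpow hβ0 (by linarith) (by nlinarith) x) hM.le
  set D := 2 * (c + c ^ 2) ^ 2 + 8 * c ^ 2 with hD
  have hD0 : 0 < D := by positivity
  set K := (1 + β ^ 2 / 2) * (3 + β) + β with hK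
  have hK0 : 0 < K := by positivity
  refine ⟨(D * K) ^ ((1 : ℝ) / 2), by positivity, fun f => ?_⟩
  rcases eq_or_ne f 0 with rfl | hf
  · have hL (g : ℝ → ℂ) : 0 ≤ L2N g :=
      Real.rpow_nonneg (integral_nonneg fun x => sq_nonneg _) _
    have h0 : L2N (fun x : ℝ => ((deriv (deriv p) x - deriv p x ^ 2 : ℝ) : ℂ) *
        (0 : 𝓢(ℝ, ℂ)) x + 2 * ((deriv p x : ℝ) : ℂ) * deriv (⇑(0 : 𝓢(ℝ, ℂ))) x) = 0 := by
      simp [L2N]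
    rw [h0]
    exact mul_nonneg (mul_nonneg (by positivity) (Real.rpow_nonneg (hL _) _))
      (Real.rpow_nonneg (hL _) _)
  refine L2N_le_of_integral_le (by positivity) ?_
  set g := SchwartzMap.derivCLM ℝ ℂ f
  set k := SchwartzMap.derivCLM ℝ ℂ g
  have hest := weighted_norms_le (f := f) (g := g) (k := k) (θ := 2 * m) hβ (by linarith) hm1
    f.hasDerivAt g.hasDerivAt (integral_norm_sq_pos hf)
  have i1 := integrable_potential_rpow_mul_norm_sq hβ0.le (by linarith : 2 * (2 * m) ≤ 2) f
  have i2 := integrable_potential_rpow_mul_norm_sq hβ0.le (by linarith : 2 * m ≤ 2) g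
  rw [← integral_add i1 i2] at hest
  have e1 : (1 + 2 * m) / 2 = 1 / 2 + m := by ring
  have e2 : (1 - 2 * m) / 2 = 1 - (1 / 2 + m) := by ring
  rw [e1, e2] at hest
  rw [mul_assoc D]
  refine le_trans ?_ (mul_le_mul_of_nonneg_left hest hD0.le)
  rw [← integral_const_mul]
  refine integral_mono_of_nonneg (Filter.Eventually.of_forall fun x => sq_nonneg _)
    ((i1.add i2).const_mul D) (Filter.Eventually.of_forall fun x => ?_)
  have hV := (potential_pos β x).le
  have h := norm_perturbation_sq_le (v := potential β x ^ (2 * m)) (ha x) (hb x)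
    (by rw [mul_comm 2 m, Real.rpow_mul hV, Real.rpow_two]) (f x) (g x)
  rw [← Real.rpow_two (potential β x ^ (2 * m)), ← Real.rpow_mul hV, mul_comm (2 * m) 2] at h
  exact h
end

section
/- Let β ≥ 2 and let δ ∈ [0, β]. There exists C > 0 such that for every Schwartz function f : ℝ → ℂ, ‖x ↦ (1+x²)^{δ/2}·f(x)‖ ≤ C·‖x ↦ -f''(x) + |x|^β·f(x) + f(x)‖^{δ/β}·‖f‖^{1−δ/β}. -/
open MeasureTheory

lemma SchwartzMap.integrable_mul_inner_of_growth {p : ℝ → ℝ} (hp : Continuous p) (A r : ℝ)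
    (hpA : ∀ x, |p x| ≤ A * (1 + |x|) ^ r) (g h : SchwartzMap ℝ ℂ) :
    Integrable (fun x => p x * inner ℝ (g x) (h x)) := by
  obtain ⟨M, hM0, hM⟩ := h.decay 0 0
  have hM' : ∀ x, ‖h x‖ ≤ M := fun x => by simpa using hM x
  have hA : 0 ≤ A := by simpa using (abs_nonneg _).trans (hpA 0)
  set n := ⌈r⌉₊
  have hint : Integrable (fun x : ℝ =>
      A * 2 ^ (n - 1) * M * (‖x‖ ^ 0 * ‖g x‖ + ‖x‖ ^ n * ‖g x‖)) :=
    ((g.integrable_pow_mul volume 0).add (g.integrable_pow_mul volume n)).const_mul _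
  refine hint.mono' (hp.mul (g.continuous.inner h.continuous)).aestronglyMeasurable
    (Filter.Eventually.of_forall fun x => ?_)
  have h1 : (1 + |x|) ^ r ≤ 2 ^ (n - 1) * (1 + |x| ^ n) :=
    calc (1 + |x|) ^ r ≤ (1 + |x|) ^ (n : ℝ) :=
          Real.rpow_le_rpow_of_exponent_le (by linarith [abs_nonneg x]) (Nat.le_ceil r)
      _ = (1 + |x|) ^ n := Real.rpow_natCast _ _
      _ ≤ 2 ^ (n - 1) * (1 + |x| ^ n) := by
          simpa using add_pow_le zero_le_one (abs_nonneg x) n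
  calc ‖p x * inner ℝ (g x) (h x)‖ = |p x| * |inner ℝ (g x) (h x)| := by
        rw [Real.norm_eq_abs, abs_mul]
    _ ≤ (A * (2 ^ (n - 1) * (1 + |x| ^ n))) * (‖g x‖ * M) := by
        gcongr
        · exact (hpA x).trans (by gcongr)
        · exact (abs_real_inner_le_norm _ _).trans (by gcongr; exact hM' x)
    _ = _ := by simp only [Real.norm_eq_abs]; ring

/-- The coercivity estimate behind the graph norm bound: if `c`, `b`, `a` are the values of a
function and of its first two derivatives, and `d` is the derivative of the weight `v + K`, then
the first summand on the right is four times the derivative of `(v + K) * inner ℝ b c`. -/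
lemma sq_mul_norm_sq_le_of_abs_deriv_le {v K d : ℝ} (hv : 1 ≤ v) (hK : 0 ≤ K)
    (hd : |d| ≤ v + K) (a b c : ℂ) :
    v ^ 2 * ‖c‖ ^ 2 ≤ 4 * (d * inner ℝ b c + (v + K) * (inner ℝ b b + inner ℝ a c))
      + 2 * (1 + K) * ‖-a + v • c‖ ^ 2 := by
  have hT : inner ℝ a c = v * ‖c‖ ^ 2 - inner ℝ (-a + v • c) c := by
    rw [inner_add_left, inner_neg_left, real_inner_smul_left, real_inner_self_eq_norm_sq]; ring
  have hq := real_inner_le_norm (-a + v • c) c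
  have hs := abs_real_inner_le_norm b c
  rw [hT, real_inner_self_eq_norm_sq]
  generalize inner ℝ (-a + v • c) c = q at *
  generalize inner ℝ b c = s at *
  generalize ‖-a + v • c‖ = t at *
  have hB := norm_nonneg b
  have hC := norm_nonneg c
  generalize ‖b‖ = B at *
  generalize ‖c‖ = C at *
  set w := v + K with hw
  have hw0 : 0 < w := by linarith
  have h1 : -(w * (B * C)) ≤ d * s := by
    have : |d * s| ≤ w * (B * C) := by
      rw [abs_mul]; exact mul_le_mul hd hs (abs_nonneg _) hw0.le
    exact (abs_le.mp this).1
  have h2 : w * q ≤ w * (t * C) := by gcongr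
  have h3 : w ≤ (1 + K) * v := by nlinarith
  have h4 : 2 * (w * (t * C)) ≤ w * v * C ^ 2 + (1 + K) * t ^ 2 := by
    have hk : 0 < 1 + K := by linarith
    have h5 : 0 ≤ (w * C - (1 + K) * t) ^ 2 := sq_nonneg _
    have h6 : w * w * C ^ 2 ≤ w * ((1 + K) * v) * C ^ 2 := by gcongr
    refine le_of_mul_le_mul_left ?_ hk
    nlinarith
  have h7 : 0 ≤ w * (B - C / 2) ^ 2 := by positivity
  have h8 : w * C ^ 2 ≤ w * v * C ^ 2 := by
    have : w * 1 * C ^ 2 ≤ w * v * C ^ 2 := by gcongr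
    linarith
  have h9 : v ^ 2 * C ^ 2 ≤ w * v * C ^ 2 := by
    have : v * v * C ^ 2 ≤ w * v * C ^ 2 := by gcongr; linarith
    nlinarith
  nlinarith

lemma mul_rpow_sub_one_le {β t : ℝ} (hβ : 1 ≤ β) (ht : 0 ≤ t) :
    β * t ^ (β - 1) ≤ t ^ β + β ^ β := by
  have hβ0 : 0 < β := by linarith
  rcases le_total β t with h | h
  · have ht0 : 0 < t := by linarith
    calc β * t ^ (β - 1) ≤ t * t ^ (β - 1) := by gcongr
      _ = t ^ β := by rw [Real.rpow_sub_one ht0.ne']; field_simp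
      _ ≤ _ := by linarith [Real.rpow_nonneg hβ0.le β]
  · calc β * t ^ (β - 1) ≤ β * β ^ (β - 1) := by gcongr
      _ = β ^ β := by rw [Real.rpow_sub_one hβ0.ne']; field_simp
      _ ≤ _ := by linarith [Real.rpow_nonneg ht β]

lemma abs_mul_abs_rpow_sub_two_mul {β : ℝ} (hβ : 2 ≤ β) (x : ℝ) :
    |β * |x| ^ (β - 2) * x| = β * |x| ^ (β - 1) := by
  rw [abs_mul, abs_mul, abs_of_nonneg (by linarith : 0 ≤ β),
    abs_of_nonneg (Real.rpow_nonneg (abs_nonneg x) _), mul_assoc]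
  congr 1
  rcases eq_or_ne x 0 with rfl | hx
  · rw [abs_zero, mul_zero, Real.zero_rpow (by linarith)]
  · rw [← Real.rpow_add_one (abs_ne_zero.mpr hx)]; ring_nf

lemma abs_rpow_le_one_add_abs_rpow {β : ℝ} (hβ : 0 ≤ β) (x : ℝ) :
    |x| ^ β ≤ (1 + |x|) ^ β :=
  Real.rpow_le_rpow (abs_nonneg x) (by linarith) hβ

lemma one_le_one_add_abs_rpow {β : ℝ} (hβ : 0 ≤ β) (x : ℝ) : 1 ≤ (1 + |x|) ^ β :=
  Real.one_le_rpow (by linarith [abs_nonneg x]) hβ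

lemma one_add_sq_rpow_le_one_add_abs_rpow {β : ℝ} (hβ : 0 ≤ β) (x : ℝ) :
    (1 + x ^ 2) ^ β ≤ (1 + |x|) ^ (2 * β) := by
  rw [Real.rpow_mul (by positivity)]
  refine Real.rpow_le_rpow (by positivity) ?_ hβ
  rw [Real.rpow_two]
  nlinarith [sq_abs x, abs_nonneg x]

lemma one_add_sq_rpow_le {β : ℝ} (hβ : 0 ≤ β) (x : ℝ) :
    (1 + x ^ 2) ^ β ≤ 2 ^ β * (|x| ^ β + 1) ^ 2 := by
  have h0 := Real.rpow_nonneg (abs_nonneg x) β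
  have hm : 1 + x ^ 2 ≤ 2 * max 1 |x| ^ 2 := by
    rcases le_total 1 |x| with h | h
    · rw [max_eq_right h, sq_abs]; nlinarith [sq_abs x]
    · rw [max_eq_left h]; nlinarith [sq_abs x, abs_nonneg x]
  have hm' : max 1 |x| ^ β ≤ |x| ^ β + 1 := by
    rcases le_total 1 |x| with h | h
    · rw [max_eq_right h]; linarith
    · rw [max_eq_left h, Real.one_rpow]; linarith
  have hm0 : 0 ≤ max 1 |x| := le_max_of_le_left zero_le_one
  calc (1 + x ^ 2) ^ β ≤ (2 * max 1 |x| ^ 2) ^ β := by gcongr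
    _ = 2 ^ β * (max 1 |x| ^ β) ^ 2 := by
        rw [Real.mul_rpow (by norm_num) (by positivity), ← Real.rpow_natCast_mul hm0,
          ← Real.rpow_mul_natCast hm0, mul_comm β _]
    _ ≤ _ := by gcongr

lemma integrable_potential_sq {β : ℝ} (hβ : 0 ≤ β) (f : SchwartzMap ℝ ℂ) :
    Integrable (fun x : ℝ => (|x| ^ β + 1) ^ 2 * ‖f x‖ ^ 2) := by
  have hVc : Continuous (fun x : ℝ => (|x| ^ β + 1) ^ 2) :=
    ((continuous_abs.rpow_const fun _ => Or.inr hβ).add continuous_const).pow 2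
  refine (SchwartzMap.integrable_mul_inner_of_growth hVc 4 (2 * β) (fun x => ?_) f f).congr
    (Filter.Eventually.of_forall fun x => by simp only [real_inner_self_eq_norm_sq])
  rw [abs_of_nonneg (sq_nonneg _), mul_comm 2 β, Real.rpow_mul (by positivity), Real.rpow_two]
  nlinarith [abs_rpow_le_one_add_abs_rpow hβ x, one_le_one_add_abs_rpow hβ x,
    Real.rpow_nonneg (abs_nonneg x) β]

lemma integrable_norm_sq_anharmonic {β : ℝ} (hβ : 2 ≤ β) (f : SchwartzMap ℝ ℂ) :
    Integrable (fun x : ℝ => ‖-(deriv (deriv ⇑f) x) + (|x| ^ β + 1) • f x‖ ^ 2) := by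
  have hβ0 : 0 ≤ β := by linarith
  have hVc : Continuous (fun x : ℝ => |x| ^ β + 1) :=
    (continuous_abs.rpow_const fun _ => Or.inr hβ0).add continuous_const
  have hV0 : ∀ x : ℝ, 0 ≤ |x| ^ β + 1 := fun x => by positivity
  have hV : ∀ x : ℝ, |x| ^ β + 1 ≤ 2 * (1 + |x|) ^ β := fun x => by
    linarith [abs_rpow_le_one_add_abs_rpow hβ0 x, one_le_one_add_abs_rpow hβ0 x]
  set D := SchwartzMap.derivCLM ℝ ℂ
  have h1 := SchwartzMap.integrable_mul_inner_of_growth (p := fun _ => 1) continuous_const 1 0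
    (fun x => by simp) (D (D f)) (D (D f))
  have h2 := SchwartzMap.integrable_mul_inner_of_growth hVc 2 β
    (fun x => by rw [abs_of_nonneg (hV0 x)]; exact hV x) (D (D f)) f
  have h3 := integrable_potential_sq hβ0 f
  refine ((h1.sub (h2.const_mul 2)).add h3).congr (Filter.Eventually.of_forall fun x => ?_)
  change 1 * inner ℝ (deriv (deriv ⇑f) x) (deriv (deriv ⇑f) x)
    - 2 * ((|x| ^ β + 1) * inner ℝ (deriv (deriv ⇑f) x) (f x))
    + (|x| ^ β + 1) ^ 2 * ‖f x‖ ^ 2 = _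
  simp only [← real_inner_self_eq_norm_sq, inner_add_left, inner_add_right, inner_neg_left,
    inner_neg_right, real_inner_smul_left, real_inner_smul_right,
    real_inner_comm (deriv (deriv ⇑f) x) (f x)]
  ring

/-- Separation property of the anharmonic oscillator: the potential term is controlled by the
graph norm. -/
lemma integral_potential_sq_le {β : ℝ} (hβ : 2 ≤ β) (f : SchwartzMap ℝ ℂ) :
    ∫ x : ℝ, (|x| ^ β + 1) ^ 2 * ‖f x‖ ^ 2 ≤ 2 * (1 + β ^ β) *
      ∫ x : ℝ, ‖-(deriv (deriv ⇑f) x) + (|x| ^ β + 1) • f x‖ ^ 2 := by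
  have hβ0 : 0 ≤ β := by linarith
  set K := β ^ β
  have hK : 0 ≤ K := Real.rpow_nonneg hβ0 β
  set D := SchwartzMap.derivCLM ℝ ℂ
  have hWc : Continuous (fun x : ℝ => |x| ^ β + 1 + K) :=
    ((continuous_abs.rpow_const fun _ => Or.inr hβ0).add continuous_const).add continuous_const
  have hdc : Continuous (fun x : ℝ => β * |x| ^ (β - 2) * x) :=
    (continuous_const.mul
      (continuous_abs.rpow_const fun _ => Or.inr (by linarith))).mul continuous_id
  have hd : ∀ x : ℝ, |β * |x| ^ (β - 2) * x| ≤ |x| ^ β + 1 + K := fun x => by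
    rw [abs_mul_abs_rpow_sub_two_mul hβ]
    linarith [mul_rpow_sub_one_le (by linarith : 1 ≤ β) (abs_nonneg x)]
  have hW : ∀ x : ℝ, |x| ^ β + 1 + K ≤ (2 + K) * (1 + |x|) ^ β := fun x => by
    nlinarith [abs_rpow_le_one_add_abs_rpow hβ0 x, one_le_one_add_abs_rpow hβ0 x]
  have hW' : ∀ x : ℝ, |(|x| ^ β + 1 + K)| ≤ (2 + K) * (1 + |x|) ^ β := fun x => by
    rw [abs_of_nonneg (by positivity)]; exact hW x
  have i1 := SchwartzMap.integrable_mul_inner_of_growth hWc (2 + K) β hW' (D f) f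
  have i2 := SchwartzMap.integrable_mul_inner_of_growth hdc (2 + K) β
    (fun x => (hd x).trans (hW x)) (D f) f
  have i3 := SchwartzMap.integrable_mul_inner_of_growth hWc (2 + K) β hW' (D f) (D f)
  have i4 := SchwartzMap.integrable_mul_inner_of_growth hWc (2 + K) β hW' (D (D f)) f
  have hH : ∀ x : ℝ, HasDerivAt (fun x : ℝ => (|x| ^ β + 1 + K) * inner ℝ (D f x) (f x))
      (β * |x| ^ (β - 2) * x * inner ℝ (D f x) (f x)
        + (|x| ^ β + 1 + K) * (inner ℝ (D f x) (D f x) + inner ℝ (D (D f) x) (f x))) x :=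
    fun x => (((hasDerivAt_abs_rpow x (by linarith)).add_const 1).add_const K).mul
      (((D f).hasDerivAt x).inner ℝ (f.hasDerivAt x))
  have iH' : Integrable (fun x : ℝ => β * |x| ^ (β - 2) * x * inner ℝ (D f x) (f x)
        + (|x| ^ β + 1 + K) * (inner ℝ (D f x) (D f x) + inner ℝ (D (D f) x) (f x))) :=
    (i2.add (i3.add i4)).congr (Filter.Eventually.of_forall fun x => by
      simp only [Pi.add_apply, mul_add])
  have h0 := integral_eq_zero_of_hasDerivAt_of_integrable hH iH' i1
  have iT := integrable_norm_sq_anharmonic hβ f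
  calc ∫ x : ℝ, (|x| ^ β + 1) ^ 2 * ‖f x‖ ^ 2
      ≤ ∫ x : ℝ, (4 * (β * |x| ^ (β - 2) * x * inner ℝ (D f x) (f x)
        + (|x| ^ β + 1 + K) * (inner ℝ (D f x) (D f x) + inner ℝ (D (D f) x) (f x)))
        + 2 * (1 + K) * ‖-(deriv (deriv ⇑f) x) + (|x| ^ β + 1) • f x‖ ^ 2) := by
        refine integral_mono_of_nonneg (Filter.Eventually.of_forall fun x => by positivity)
          ((iH'.const_mul 4).add (iT.const_mul _)) (Filter.Eventually.of_forall fun x => ?_)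
        exact sq_mul_norm_sq_le_of_abs_deriv_le
          (by linarith [Real.rpow_nonneg (abs_nonneg x) β]) hK (hd x) _ _ _
    _ = _ := by
        rw [integral_add (iH'.const_mul 4) (iT.const_mul _), integral_const_mul,
          integral_const_mul, h0, mul_zero, zero_add]

lemma integral_rpow_mul_rpow_le_s12 {F G : ℝ → ℝ} (hF : Integrable F) (hG : Integrable G)
    (hF0 : ∀ x, 0 ≤ F x) (hG0 : ∀ x, 0 ≤ G x) {p q : ℝ} (hp : 0 ≤ p) (hq : 0 ≤ q)
    (hpq : p + q = 1) :
    ∫ x, F x ^ p * G x ^ q ≤ (∫ x, F x) ^ p * (∫ x, G x) ^ q := by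
  have hF1 : 0 ≤ ∫ x, F x := integral_nonneg hF0
  have hG1 : 0 ≤ ∫ x, G x := integral_nonneg hG0
  have key := ENNReal.lintegral_mul_norm_pow_le (μ := volume)
    hF.aemeasurable.ennreal_ofReal hG.aemeasurable.ennreal_ofReal hp hq hpq
  rw [← ofReal_integral_eq_lintegral_ofReal hF (Filter.Eventually.of_forall hF0),
    ← ofReal_integral_eq_lintegral_ofReal hG (Filter.Eventually.of_forall hG0),
    ENNReal.ofReal_rpow_of_nonneg hF1 hp, ENNReal.ofReal_rpow_of_nonneg hG1 hq,
    ← ENNReal.ofReal_mul (by positivity)] at key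
  rw [integral_eq_lintegral_of_nonneg_ae
    (Filter.Eventually.of_forall fun x =>
      mul_nonneg (Real.rpow_nonneg (hF0 x) _) (Real.rpow_nonneg (hG0 x) _))
    ((hF.aemeasurable.pow_const p).mul (hG.aemeasurable.pow_const q)).aestronglyMeasurable]
  refine ENNReal.toReal_le_of_le_ofReal (by positivity) (le_trans (le_of_eq ?_) key)
  refine lintegral_congr fun x => ?_
  rw [ENNReal.ofReal_mul (Real.rpow_nonneg (hF0 x) _),
    ENNReal.ofReal_rpow_of_nonneg (hF0 x) hp, ENNReal.ofReal_rpow_of_nonneg (hG0 x) hq]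

/-- Interpolation bound of polynomial weights against the graph norm of the anharmonic
oscillator `T = -d²/dx² + |x|^β`. -/
theorem stmt_12 (β δ : ℝ) (hβ : 2 ≤ β) (hδ0 : 0 ≤ δ) (hδβ : δ ≤ β) :
    ∃ C : ℝ, 0 < C ∧
      ∀ f : SchwartzMap ℝ ℂ,
        L2N (fun x : ℝ => (((1 + x ^ 2) ^ (δ / 2) : ℝ) : ℂ) * f x)
          ≤ C * L2N (fun x : ℝ => -(deriv (deriv ⇑f) x) + ((|x| ^ β : ℝ) : ℂ) * f x + f x)
                  ^ (δ / β)
              * L2N ⇑f ^ (1 - δ / β) := by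
  have hβ0 : 0 < β := by linarith
  set θ := δ / β with hθ
  have hθ0 : 0 ≤ θ := by positivity
  have hθ1 : 0 ≤ 1 - θ := by
    rw [sub_nonneg, hθ]; exact div_le_one_of_le₀ hδβ hβ0.le
  set M : ℝ := 2 ^ β * (2 * (1 + β ^ β)) with hM
  have hM0 : 0 < M := by positivity
  refine ⟨(M ^ θ) ^ ((1 : ℝ) / 2), by positivity, fun f => ?_⟩
  have hT : (fun x : ℝ => -(deriv (deriv ⇑f) x) + ((|x| ^ β : ℝ) : ℂ) * f x + f x)
      = fun x : ℝ => -(deriv (deriv ⇑f) x) + (|x| ^ β + 1) • f x := by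
    funext x
    rw [add_smul, one_smul, Complex.real_smul, add_assoc]
  have hwc : ∀ r : ℝ, Continuous fun x : ℝ => (1 + x ^ 2) ^ r := fun r =>
    (by fun_prop : Continuous fun x : ℝ => 1 + x ^ 2).rpow_const fun x => Or.inl (by positivity)
  have iG : Integrable (fun x : ℝ => ‖f x‖ ^ 2) :=
    (SchwartzMap.integrable_mul_inner_of_growth (p := fun _ => 1) continuous_const 1 0
      (fun x => by simp) f f).congr (Filter.Eventually.of_forall fun x => by
        simp only [real_inner_self_eq_norm_sq, one_mul])
  have iF : Integrable (fun x : ℝ => (1 + x ^ 2) ^ β * ‖f x‖ ^ 2) :=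
    (SchwartzMap.integrable_mul_inner_of_growth (hwc β) 1 (2 * β)
      (fun x => by
        rw [abs_of_nonneg (by positivity), one_mul]
        exact one_add_sq_rpow_le_one_add_abs_rpow hβ0.le x) f f).congr
      (Filter.Eventually.of_forall fun x => by simp only [real_inner_self_eq_norm_sq])
  have iV := integrable_potential_sq hβ0.le f
  have hFT : ∫ x : ℝ, (1 + x ^ 2) ^ β * ‖f x‖ ^ 2 ≤
      M * ∫ x : ℝ, ‖-(deriv (deriv ⇑f) x) + (|x| ^ β + 1) • f x‖ ^ 2 :=
    calc ∫ x : ℝ, (1 + x ^ 2) ^ β * ‖f x‖ ^ 2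
        ≤ ∫ x : ℝ, 2 ^ β * ((|x| ^ β + 1) ^ 2 * ‖f x‖ ^ 2) :=
          integral_mono iF (iV.const_mul _) fun x => by
            simp only [← mul_assoc]
            exact mul_le_mul_of_nonneg_right (one_add_sq_rpow_le hβ0.le x) (sq_nonneg _)
      _ = 2 ^ β * ∫ x : ℝ, (|x| ^ β + 1) ^ 2 * ‖f x‖ ^ 2 := integral_const_mul _ _
      _ ≤ _ := by
          rw [hM, mul_assoc]
          exact mul_le_mul_of_nonneg_left (integral_potential_sq_le hβ f) (by positivity)
  have hL : (fun x : ℝ => ‖(((1 + x ^ 2) ^ (δ / 2) : ℝ) : ℂ) * f x‖ ^ 2) =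
      fun x : ℝ => ((1 + x ^ 2) ^ β * ‖f x‖ ^ 2) ^ θ * (‖f x‖ ^ 2) ^ (1 - θ) := by
    funext x
    have h1 : 0 ≤ 1 + x ^ 2 := by positivity
    have hβθ : β * θ = δ := by rw [hθ]; field_simp
    rw [norm_mul, Complex.norm_real, Real.norm_of_nonneg (by positivity), mul_pow,
      ← Real.rpow_mul_natCast h1, Real.mul_rpow (by positivity) (by positivity),
      ← Real.rpow_mul h1, hβθ, mul_assoc,
      ← Real.rpow_add_of_nonneg (by positivity) hθ0 hθ1, add_sub_cancel, Real.rpow_one]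
    norm_num
  have hmain := integral_rpow_mul_rpow_le_s12 iF iG (fun x => by positivity) (fun x => by positivity)
    hθ0 hθ1 (add_sub_cancel _ _)
  rw [hT]
  unfold L2N
  rw [hL]
  have hF0 : 0 ≤ ∫ x : ℝ, (1 + x ^ 2) ^ β * ‖f x‖ ^ 2 :=
    integral_nonneg fun x => by positivity
  have hT0 : 0 ≤ ∫ x : ℝ, ‖-(deriv (deriv ⇑f) x) + (|x| ^ β + 1) • f x‖ ^ 2 :=
    integral_nonneg fun x => by positivity
  have hG0 : 0 ≤ ∫ x : ℝ, ‖f x‖ ^ 2 := integral_nonneg fun x => by positivity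
  generalize (∫ x : ℝ, ‖-(deriv (deriv ⇑f) x) + (|x| ^ β + 1) • f x‖ ^ 2) = t at *
  generalize (∫ x : ℝ, ‖f x‖ ^ 2) = g at *
  have hswap : ∀ {y : ℝ} (r : ℝ), 0 ≤ y → (y ^ ((1 : ℝ) / 2)) ^ r = (y ^ r) ^ ((1 : ℝ) / 2) :=
    fun r hy => by rw [← Real.rpow_mul hy, ← Real.rpow_mul hy, mul_comm]
  rw [hswap θ hT0, hswap (1 - θ) hG0, ← Real.mul_rpow (by positivity) (by positivity),
    ← Real.mul_rpow (by positivity) (by positivity), ← Real.mul_rpow hM0.le hT0]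
  refine Real.rpow_le_rpow (integral_nonneg fun x => by positivity) (hmain.trans ?_) (by norm_num)
  gcongr
end

section
/- Let β ≥ 2 and let j ∈ {0, 1, 2}. There exists C > 0 such that for every Schwartz function f : ℝ → ℂ, ‖f^{(j)}‖ ≤ C·‖x ↦ -f''(x) + |x|^β·f(x) + f(x)‖^{j/2}·‖f‖^{1−j/2}, where f^{(j)} denotes the j-th derivative of f. -/
open MeasureTheory

open scoped InnerProductSpace

namespace SchwartzMap

/-- A continuous function dominated by a polynomial weight times the product of two Schwartz
functions is integrable. -/
theorem integrable_of_abs_le_weight {h : ℝ → ℝ} (hc : Continuous h) (u v : SchwartzMap ℝ ℂ)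
    {A : ℝ} {n : ℕ} (hA : 0 ≤ A) (hb : ∀ x, |h x| ≤ A * (1 + |x|) ^ n * (‖u x‖ * ‖v x‖)) :
    Integrable h := by
  obtain ⟨M, hM0, hM⟩ : ∃ M : ℝ, 0 ≤ M ∧ ∀ x, ‖v x‖ ≤ M :=
    ⟨SchwartzMap.seminorm ℝ 0 0 v, apply_nonneg _ _, fun x => v.norm_le_seminorm ℝ x⟩
  have h1 : Integrable fun x => A * M * 2 ^ (n - 1) * (‖u x‖ + ‖x‖ ^ n * ‖u x‖) :=
    (u.integrable.norm.add (u.integrable_pow_mul volume n)).const_mul _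
  refine h1.mono' hc.aestronglyMeasurable (.of_forall fun x => ?_)
  rw [Real.norm_eq_abs, Real.norm_eq_abs]
  have h2 : (1 + |x|) ^ n ≤ 2 ^ (n - 1) * (1 + |x| ^ n) := by
    simpa using add_pow_le zero_le_one (abs_nonneg x) n
  calc |h x| ≤ A * (1 + |x|) ^ n * (‖u x‖ * ‖v x‖) := hb x
    _ ≤ A * (2 ^ (n - 1) * (1 + |x| ^ n)) * (‖u x‖ * M) := by
        gcongr
        exact hM x
    _ = _ := by ring

/-- Integration by parts for `⟪f', f⟫` against a weight of polynomial growth. -/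
theorem integral_weighted_inner_deriv_eq_zero {W W' : ℝ → ℝ} (hW : ∀ x, HasDerivAt W (W' x) x)
    (hW' : Continuous W') {A : ℝ} {n : ℕ} (hA : 0 ≤ A) (hb : ∀ x, |W x| ≤ A * (1 + |x|) ^ n)
    (hb' : ∀ x, |W' x| ≤ A * (1 + |x|) ^ n) (f : SchwartzMap ℝ ℂ) :
    Integrable (fun x => W x * ⟪deriv (deriv f) x, f x⟫_ℝ) ∧
    Integrable (fun x => W x * ‖deriv f x‖ ^ 2 + W' x * ⟪deriv f x, f x⟫_ℝ) ∧
    ∫ x, W x * ⟪deriv (deriv f) x, f x⟫_ℝ =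
      -∫ x, (W x * ‖deriv f x‖ ^ 2 + W' x * ⟪deriv f x, f x⟫_ℝ) := by
  obtain ⟨f₁, hf₁⟩ : ∃ f₁ : SchwartzMap ℝ ℂ, (f₁ : ℝ → ℂ) = deriv f :=
    ⟨derivCLM ℝ ℂ f, rfl⟩
  obtain ⟨f₂, hf₂⟩ : ∃ f₂ : SchwartzMap ℝ ℂ, (f₂ : ℝ → ℂ) = deriv f₁ :=
    ⟨derivCLM ℝ ℂ f₁, rfl⟩
  rw [← hf₁, ← hf₂]
  have hWc : Continuous W := continuous_iff_continuousAt.2 fun x => (hW x).continuousAt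
  have key : ∀ {w : ℝ → ℝ}, Continuous w → (∀ x, |w x| ≤ A * (1 + |x|) ^ n) →
      ∀ u v : SchwartzMap ℝ ℂ, Integrable fun x => w x * ⟪u x, v x⟫_ℝ := by
    intro w hw hwb u v
    refine integrable_of_abs_le_weight (hw.mul (u.continuous.inner v.continuous)) u v hA
      (n := n) fun x => ?_
    rw [abs_mul]
    exact mul_le_mul (hwb x) (abs_real_inner_le_norm _ _) (abs_nonneg _) (by positivity)
  have i2 := key hWc hb f₂ f
  have i1 : Integrable fun x => W x * ‖f₁ x‖ ^ 2 := by
    simpa only [real_inner_self_eq_norm_sq] using key hWc hb f₁ f₁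
  have i0 := key hW' hb' f₁ f
  have ib := i1.add i0
  refine ⟨i2, ib, ?_⟩
  have hd : ∀ x, HasDerivAt (fun x => W x * ⟪f₁ x, f x⟫_ℝ)
      ((W x * ‖f₁ x‖ ^ 2 + W' x * ⟪f₁ x, f x⟫_ℝ) + W x * ⟪f₂ x, f x⟫_ℝ) x := by
    intro x
    have h0 : HasDerivAt f (f₁ x) x := by rw [hf₁]; exact f.hasDerivAt x
    have h1 : HasDerivAt f₁ (f₂ x) x := by rw [hf₂]; exact f₁.hasDerivAt x
    refine ((hW x).mul (h1.inner ℝ h0)).congr_deriv ?_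
    rw [real_inner_self_eq_norm_sq]
    ring
  have h := integral_eq_zero_of_hasDerivAt_of_integrable hd (ib.add i2) (key hWc hb f₁ f)
  have h' := integral_add ib i2
  simp only [Pi.add_apply] at h'
  linarith

end SchwartzMap

theorem abs_rpow_sub_two_mul_abs_le {β : ℝ} (hβ : 2 ≤ β) (x : ℝ) :
    |x| ^ (β - 2) * |x| ≤ |x| ^ β + 1 := by
  rcases le_total |x| 1 with h | h
  · have h1 := Real.rpow_le_one (abs_nonneg x) h (sub_nonneg.2 hβ)
    have h2 := Real.rpow_nonneg (abs_nonneg x) (β - 2)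
    have h3 := Real.rpow_nonneg (abs_nonneg x) β
    nlinarith [abs_nonneg x]
  · have h1 : |x| ^ β = |x| ^ (β - 2) * |x| ^ 2 := by
      rw [← Real.rpow_add_natCast (by positivity)]
      norm_num
    have h2 := Real.rpow_nonneg (abs_nonneg x) (β - 2)
    rw [h1]
    nlinarith [mul_nonneg h2 (mul_nonneg (abs_nonneg x) (sub_nonneg.2 h))]

theorem abs_rpow_add_one_le {β : ℝ} (hβ : 2 ≤ β) (x : ℝ) :
    |x| ^ β + 1 ≤ 2 * (1 + |x|) ^ ⌈β⌉₊ := by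
  have h0 := abs_nonneg x
  have h1 : |x| ^ β ≤ (1 + |x|) ^ ⌈β⌉₊ := by
    rw [← Real.rpow_natCast]
    calc |x| ^ β ≤ (1 + |x|) ^ β := by gcongr; linarith
      _ ≤ _ := Real.rpow_le_rpow_of_exponent_le (by linarith) (Nat.le_ceil β)
  have h2 : 1 ≤ (1 + |x|) ^ ⌈β⌉₊ := one_le_pow₀ (by linarith)
  linarith

/-- Energy and graph-norm estimates for `-f'' + (|x| ^ β + 1) f`, for squared `L²` norms. -/
theorem anharmonic_estimates {β : ℝ} (hβ : 2 ≤ β) (f : SchwartzMap ℝ ℂ) {g : ℝ → ℂ}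
    (hg : ∀ x, g x = (|x| ^ β + 1) • f x - deriv (deriv f) x) :
    (∫ x, ‖deriv f x‖ ^ 2) ≤
      (∫ x, ‖g x‖ ^ 2) ^ ((1 : ℝ) / 2) * (∫ x, ‖f x‖ ^ 2) ^ ((1 : ℝ) / 2) ∧
    (∫ x, ‖deriv (deriv f) x‖ ^ 2) ≤ (1 + β ^ 2 / 2) * ∫ x, ‖g x‖ ^ 2 := by
  obtain ⟨V, hV⟩ : ∃ V : ℝ → ℝ, V = fun x => |x| ^ β + 1 := ⟨_, rfl⟩
  obtain ⟨V', hV'⟩ : ∃ V' : ℝ → ℝ, V' = fun x => β * |x| ^ (β - 2) * x := ⟨_, rfl⟩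
  have hVd : ∀ x, HasDerivAt V (V' x) x := fun x => by
    rw [hV, hV']
    exact (hasDerivAt_abs_rpow x (by linarith)).add_const 1
  have hVc : Continuous V := continuous_iff_continuousAt.2 fun x => (hVd x).continuousAt
  have hVc' : Continuous V' := by
    rw [hV']
    exact (continuous_const.mul (continuous_abs.rpow_const fun x => .inr (by linarith))).mul
      continuous_id
  have hV1 : ∀ x, 1 ≤ V x := fun x => by
    rw [hV]
    linarith [Real.rpow_nonneg (abs_nonneg x) β]
  have hVV : ∀ x, |V' x| ≤ β * V x := fun x => by
    rw [hV, hV', abs_mul, abs_mul, abs_of_nonneg (by linarith : 0 ≤ β),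
      abs_of_nonneg (Real.rpow_nonneg (abs_nonneg x) _), mul_assoc]
    exact mul_le_mul_of_nonneg_left (abs_rpow_sub_two_mul_abs_le hβ x) (by linarith)
  have hVb : ∀ x, V x ≤ 2 * (1 + |x|) ^ ⌈β⌉₊ := fun x => by
    rw [hV]
    exact abs_rpow_add_one_le hβ x
  have hVb1 : ∀ x, |V x| ≤ 2 * β * (1 + |x|) ^ ⌈β⌉₊ := fun x => by
    rw [abs_of_nonneg (by linarith [hV1 x])]
    nlinarith [hVb x, hV1 x]
  have hVb2 : ∀ x, |V' x| ≤ 2 * β * (1 + |x|) ^ ⌈β⌉₊ := fun x => by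
    nlinarith [hVb x, hVV x]
  replace hg : ∀ x, g x = V x • f x - deriv (deriv f) x := by rw [hV]; exact hg
  obtain ⟨iJ, j2, hj⟩ := f.integral_weighted_inner_deriv_eq_zero hVd hVc' (by linarith) hVb1 hVb2
  obtain ⟨k1, -, hk⟩ := f.integral_weighted_inner_deriv_eq_zero (W := fun _ => 1)
    (W' := fun _ => 0) (fun x => hasDerivAt_const x 1) continuous_const (A := 1) (n := 0)
    zero_le_one (by simp) (by simp)
  simp only [one_mul, zero_mul, add_zero] at k1 hk
  obtain ⟨f₁, hf₁⟩ : ∃ f₁ : SchwartzMap ℝ ℂ, (f₁ : ℝ → ℂ) = deriv f :=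
    ⟨SchwartzMap.derivCLM ℝ ℂ f, rfl⟩
  obtain ⟨f₂, hf₂⟩ : ∃ f₂ : SchwartzMap ℝ ℂ, (f₂ : ℝ → ℂ) = deriv f₁ :=
    ⟨SchwartzMap.derivCLM ℝ ℂ f₁, rfl⟩
  simp only [← hf₁, ← hf₂] at hg iJ j2 hj k1 hk ⊢
  have hgc : Continuous g := by
    rw [funext hg]
    exact (hVc.smul f.continuous).sub f₂.continuous
  have iF : Integrable fun x => ‖f x‖ ^ 2 := (f.memLp 2).integrable_norm_pow (p := 2) (by simp)
  have iD : Integrable fun x => ‖f₂ x‖ ^ 2 := (f₂.memLp 2).integrable_norm_pow (p := 2) (by simp)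
  have iP : Integrable fun x => V x * ‖f x‖ ^ 2 := by
    refine SchwartzMap.integrable_of_abs_le_weight (hVc.mul (f.continuous.norm.pow 2)) f f
      (by linarith : 0 ≤ 2 * β) (n := ⌈β⌉₊) fun x => ?_
    rw [abs_mul, abs_of_nonneg (sq_nonneg ‖f x‖), ← sq]
    exact mul_le_mul_of_nonneg_right (hVb1 x) (sq_nonneg _)
  have iQ : Integrable fun x => V x ^ 2 * ‖f x‖ ^ 2 := by
    refine SchwartzMap.integrable_of_abs_le_weight
      ((hVc.pow 2).mul (f.continuous.norm.pow 2)) f f (A := (2 * β) ^ 2) (by positivity)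
      (n := ⌈β⌉₊ * 2) fun x => ?_
    rw [abs_mul, abs_of_nonneg (sq_nonneg ‖f x‖), ← sq ‖f x‖, abs_pow, pow_mul, ← mul_pow (2 * β)]
    exact mul_le_mul_of_nonneg_right (pow_le_pow_left₀ (abs_nonneg _) (hVb1 x) 2) (sq_nonneg _)
  have hsq : ∀ x, ‖g x‖ ^ 2 = V x ^ 2 * ‖f x‖ ^ 2 - 2 * (V x * ⟪f₂ x, f x⟫_ℝ) + ‖f₂ x‖ ^ 2 :=
    fun x => by
      rw [hg, norm_sub_sq_real, norm_smul, real_inner_smul_left, real_inner_comm, mul_pow,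
        Real.norm_eq_abs, sq_abs]
  have iG : Integrable fun x => ‖g x‖ ^ 2 := by
    simp only [hsq]
    exact (iQ.sub (iJ.const_mul 2)).add iD
  have energy : (∫ x, ‖f₁ x‖ ^ 2) + ∫ x, V x * ‖f x‖ ^ 2 ≤
      (∫ x, ‖g x‖ ^ 2) ^ ((1 : ℝ) / 2) * (∫ x, ‖f x‖ ^ 2) ^ ((1 : ℝ) / 2) := by
    have hCS := integral_mul_le_Lp_mul_Lq_of_nonneg (μ := (volume : Measure ℝ))
      (f := fun x => ‖g x‖) (g := fun x => ‖f x‖) Real.HolderConjugate.two_two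
      (.of_forall fun x => norm_nonneg _) (.of_forall fun x => norm_nonneg _)
      (by
        rw [ENNReal.ofReal_ofNat]
        exact ((memLp_two_iff_integrable_sq_norm hgc.aestronglyMeasurable).2 iG).norm)
      (by
        rw [ENNReal.ofReal_ofNat]
        exact (f.memLp 2).norm)
    simp only [Real.rpow_two] at hCS
    refine le_trans ?_ hCS
    have hi : ∀ x, ⟪g x, f x⟫_ℝ = V x * ‖f x‖ ^ 2 - ⟪f₂ x, f x⟫_ℝ := fun x => by
      rw [hg, inner_sub_left, real_inner_smul_left, real_inner_self_eq_norm_sq]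
    have hs := integral_sub iP k1
    calc _ = ∫ x, (V x * ‖f x‖ ^ 2 - ⟪f₂ x, f x⟫_ℝ) := by rw [hs, hk]; ring
      _ ≤ _ := by
        refine integral_mono (iP.sub k1) ?_ fun x => ?_
        · refine (iG.add iF).mono' (hgc.norm.mul f.continuous.norm).aestronglyMeasurable
            (.of_forall fun x => ?_)
          rw [Real.norm_eq_abs, abs_of_nonneg (by positivity)]
          simp only [Pi.add_apply]
          nlinarith [sq_nonneg (‖g x‖ - ‖f x‖), sq_nonneg (‖g x‖), sq_nonneg (‖f x‖)]
        · simp only [← hi]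
          exact real_inner_le_norm _ _
  have hD0 : 0 ≤ ∫ x, ‖f₁ x‖ ^ 2 := integral_nonneg fun x => sq_nonneg _
  have hF0 : 0 ≤ ∫ x, ‖f x‖ ^ 2 := integral_nonneg fun x => sq_nonneg _
  have hG0 : 0 ≤ ∫ x, ‖g x‖ ^ 2 := integral_nonneg fun x => sq_nonneg _
  have hFP : ∫ x, ‖f x‖ ^ 2 ≤ ∫ x, V x * ‖f x‖ ^ 2 :=
    integral_mono iF iP fun x => le_mul_of_one_le_left (sq_nonneg _) (hV1 x)
  refine ⟨by linarith, ?_⟩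
  have hPG : ∫ x, V x * ‖f x‖ ^ 2 ≤ ∫ x, ‖g x‖ ^ 2 := by
    rw [← Real.sqrt_eq_rpow, ← Real.sqrt_eq_rpow] at energy
    nlinarith [Real.sq_sqrt hF0, Real.sq_sqrt hG0,
      sq_nonneg (√(∫ x, ‖g x‖ ^ 2) - √(∫ x, ‖f x‖ ^ 2))]
  have hlow : -(β ^ 2 / 4) * ∫ x, V x * ‖f x‖ ^ 2 ≤
      ∫ x, (V x * ‖f₁ x‖ ^ 2 + V' x * ⟪f₁ x, f x⟫_ℝ) := by
    rw [← integral_const_mul]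
    refine integral_mono (iP.const_mul _) j2 fun x => ?_
    have h1 : |V' x * ⟪f₁ x, f x⟫_ℝ| ≤ β * V x * (‖f₁ x‖ * ‖f x‖) := by
      rw [abs_mul]
      exact mul_le_mul (hVV x) (abs_real_inner_le_norm _ _) (abs_nonneg _)
        (mul_nonneg (by linarith) (by linarith [hV1 x]))
    have h2 := mul_nonneg (by linarith [hV1 x] : 0 ≤ V x)
      (sq_nonneg (‖f₁ x‖ - β / 2 * ‖f x‖))
    have h3 := (abs_le.1 h1).1
    simp only
    nlinarith
  have hexp : ∫ x, ‖g x‖ ^ 2 = (∫ x, V x ^ 2 * ‖f x‖ ^ 2) - 2 * (∫ x, V x * ⟪f₂ x, f x⟫_ℝ)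
      + ∫ x, ‖f₂ x‖ ^ 2 := by
    simp only [hsq]
    rw [← integral_const_mul, ← integral_sub iQ (iJ.const_mul 2)]
    exact integral_add (iQ.sub (iJ.const_mul 2)) iD
  have hQ0 : 0 ≤ ∫ x, V x ^ 2 * ‖f x‖ ^ 2 := integral_nonneg fun x => by positivity
  nlinarith [mul_le_mul_of_nonneg_left hPG (sq_nonneg β)]

/-- Interpolation bound of derivatives against the graph norm of the anharmonic
oscillator `T = -d²/dx² + |x|^β`. -/
theorem stmt_13 (β : ℝ) (hβ : 2 ≤ β) (j : ℕ) (hj : j ≤ 2) :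
    ∃ C : ℝ, 0 < C ∧
      ∀ f : SchwartzMap ℝ ℂ,
        L2N (iteratedDeriv j ⇑f)
          ≤ C * L2N (fun x : ℝ => -(deriv (deriv ⇑f) x) + ((|x| ^ β : ℝ) : ℂ) * f x + f x)
                  ^ ((j : ℝ) / 2)
              * L2N ⇑f ^ (1 - (j : ℝ) / 2) := by
  refine ⟨(1 + β ^ 2 / 2) ^ ((1 : ℝ) / 2), by positivity, fun f => ?_⟩
  obtain ⟨g, hg⟩ : ∃ g : ℝ → ℂ,
      g = fun x : ℝ => -(deriv (deriv ⇑f) x) + ((|x| ^ β : ℝ) : ℂ) * f x + f x := ⟨_, rfl⟩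
  obtain ⟨h1, h2⟩ := anharmonic_estimates hβ f (g := g) fun x => by
    rw [hg, Complex.real_smul]
    push_cast
    ring
  rw [← hg]
  have hC : 1 ≤ (1 + β ^ 2 / 2) ^ ((1 : ℝ) / 2) :=
    Real.one_le_rpow (by nlinarith [sq_nonneg β]) (by norm_num)
  have hnn : ∀ u : ℝ → ℂ, 0 ≤ ∫ x, ‖u x‖ ^ 2 := fun u => integral_nonneg fun x => sq_nonneg _
  have hL : ∀ u, 0 ≤ L2N u := fun u => Real.rpow_nonneg (hnn u) _
  interval_cases j
  · simpa using le_mul_of_one_le_left (hL f) hC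
  · rw [iteratedDeriv_one]
    have h3 : L2N (deriv f) ≤ L2N g ^ ((1 : ℝ) / 2) * L2N f ^ ((1 : ℝ) / 2) := by
      rw [← Real.mul_rpow (hL g) (hL f)]
      exact Real.rpow_le_rpow (hnn _) h1 (by norm_num)
    have h4 : (1 : ℝ) - ((1 : ℕ) : ℝ) / 2 = 1 / 2 := by norm_num
    rw [h4, Nat.cast_one, mul_assoc]
    exact h3.trans (le_mul_of_one_le_left
      (mul_nonneg (Real.rpow_nonneg (hL g) _) (Real.rpow_nonneg (hL f) _)) hC)
  · rw [iteratedDeriv_succ, iteratedDeriv_one]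
    norm_num only [Nat.cast_ofNat, div_self, sub_self, Real.rpow_one, Real.rpow_zero, mul_one]
    unfold L2N
    rw [← Real.mul_rpow (by positivity) (hnn g)]
    exact Real.rpow_le_rpow (hnn _) h2 (by norm_num)
end
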